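/- arXiv:1512.02424 — 5 statements merged into one kernel-verified Lean document; each statement's English description precedes it below -/
import Mathlib

section
/- Let μ > 0 and 0 < γ ≤ 1, and let S = ℝ² × (−1, 0) be the flat strip. Suppose U = (V₁, V₂, w) : ℝ² × [−1, 0] → ℝ³ is continuously differentiable on the closed strip, square integrable on S, and satisfies: (divergence-free) √μ ∂ₓV₁ + γ√μ ∂_yV₂ + ∂_z w = 0 on S; (curl-free) √μ γ ∂_y w − ∂_z V₂ = 0, ∂_z V₁ − √μ ∂ₓ w = 0 and √μ ∂ₓ V₂ − √μ γ ∂_y V₁ = 0 on S; and the boundary conditions w(x, y, −1) = 0 and w(x, y, 0) = 0 for all (x, y) ∈ ℝ². Then U = 0 identically on S. -/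
open MeasureTheory Set

theorem two_pi_mul_enorm_le_lintegral_circleMap {f : ℂ → ℂ} (hf : Differentiable ℂ f) (c : ℂ) (r : ℝ) :
    ENNReal.ofReal (2 * Real.pi) * ‖f c‖ₑ ≤
      ∫⁻ θ in Ioo (-Real.pi) Real.pi, ‖f (circleMap c r θ)‖ₑ := by
  have h1 : Real.circleAverage f c r = f c := (hf.diffContOnCl).circleAverage
  rw [Real.circleAverage_eq_integral_add (-Real.pi),
    intervalIntegral.integral_comp_add_right (fun θ => f (circleMap c r θ)),
    intervalIntegral.integral_of_le (by linarith [Real.pi_pos])] at h1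
  rw [← h1, enorm_smul, ← mul_assoc]
  have h2 : ENNReal.ofReal (2 * Real.pi) * ‖(2 * Real.pi)⁻¹‖ₑ = 1 := by
    rw [Real.enorm_of_nonneg (by positivity), ← ENNReal.ofReal_mul (by positivity),
      mul_inv_cancel₀ (by positivity), ENNReal.ofReal_one]
  rw [h2, one_mul, restrict_Ioo_eq_restrict_Ioc, zero_add,
    show 2 * Real.pi + -Real.pi = Real.pi by ring]
  exact enorm_integral_le_lintegral_enorm _

theorem Differentiable.eq_zero_of_integrable {f : ℂ → ℂ} (hf : Differentiable ℂ f)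
    (hi : Integrable f) : f = 0 := by
  funext c
  have hg : Differentiable ℂ (fun z => f (z + c)) := by fun_prop
  have hgi : Integrable (fun z => f (z + c)) := hi.comp_add_right c
  by_contra hne
  have hlt : ∫⁻ z, ‖f (z + c)‖ₑ < ⊤ := hgi.2
  have hm : Measurable fun p : ℝ × ℝ =>
      ENNReal.ofReal p.1 * ‖f (Complex.polarCoord.symm p + c)‖ₑ := by
    have := hf.continuous.measurable
    simp only [Complex.polarCoord_symm_apply]
    fun_prop
  rw [← Complex.lintegral_comp_polarCoord_symm, polarCoord_target, Measure.volume_eq_prod] at hlt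
  simp only [smul_eq_mul] at hlt
  rw [setLIntegral_prod _ hm.aemeasurable] at hlt
  have hle : ∫⁻ r in Ioi (0 : ℝ), ENNReal.ofReal r * (ENNReal.ofReal (2 * Real.pi) * ‖f c‖ₑ) ≤
      ∫⁻ r in Ioi (0 : ℝ), ∫⁻ θ in Ioo (-Real.pi) Real.pi,
        ENNReal.ofReal r * ‖f (Complex.polarCoord.symm (r, θ) + c)‖ₑ := by
    refine lintegral_mono fun r => ?_
    rw [lintegral_const_mul' _ _ ENNReal.ofReal_ne_top]
    gcongr
    have := two_pi_mul_enorm_le_lintegral_circleMap hg 0 r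
    simpa [Complex.polarCoord_symm_apply, circleMap, Complex.exp_mul_I] using this
  refine (hle.trans_lt hlt).ne ?_
  rw [lintegral_mul_const _ (by fun_prop)]
  have h3 : ∫⁻ r in Ioi (0 : ℝ), ENNReal.ofReal r = ⊤ := by
    refine top_unique ?_
    calc (⊤ : ENNReal) = ∫⁻ r in Ioi (1 : ℝ), 1 := by simp
      _ ≤ ∫⁻ r in Ioi (1 : ℝ), ENNReal.ofReal r := by
        refine setLIntegral_mono (by fun_prop) fun r hr => ?_
        simpa using (le_of_lt hr : (1 : ℝ) ≤ r)
      _ ≤ _ := lintegral_mono_set (Ioi_subset_Ioi zero_le_one)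
  rw [h3, ENNReal.top_mul]
  have : 0 < 2 * Real.pi := by positivity
  simp only [ne_eq, mul_eq_zero, ENNReal.ofReal_eq_zero, enorm_eq_zero, not_or]
  exact ⟨by linarith, hne⟩

/-- The open flat strip `ℝ² × (-1, 0)`. -/
def openStrip : Set (ℝ × ℝ × ℝ) := {p | p.2.2 ∈ Ioo (-1 : ℝ) 0}

/-- The closed flat strip `ℝ² × [-1, 0]`. -/
def closedStrip : Set (ℝ × ℝ × ℝ) := {p | p.2.2 ∈ Icc (-1 : ℝ) 0}

theorem openStrip_eq_prod : openStrip = univ ×ˢ (univ ×ˢ Ioo (-1 : ℝ) 0) := by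
  ext p; simp [openStrip]

theorem closedStrip_eq_prod : closedStrip = univ ×ˢ (univ ×ˢ Icc (-1 : ℝ) 0) := by
  ext p; simp [closedStrip]

theorem isOpen_openStrip : IsOpen openStrip := by
  rw [openStrip_eq_prod]
  exact isOpen_univ.prod (isOpen_univ.prod isOpen_Ioo)

theorem openStrip_subset_closedStrip : openStrip ⊆ closedStrip := fun _ hp =>
  Ioo_subset_Icc_self hp

theorem closedStrip_mem_nhds {p : ℝ × ℝ × ℝ} (hp : p ∈ openStrip) : closedStrip ∈ nhds p :=
  Filter.mem_of_superset (isOpen_openStrip.mem_nhds hp) openStrip_subset_closedStrip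

theorem uniqueDiffOn_closedStrip : UniqueDiffOn ℝ closedStrip := by
  rw [closedStrip_eq_prod]
  exact uniqueDiffOn_univ.prod (uniqueDiffOn_univ.prod (uniqueDiffOn_Icc (by norm_num)))

section Strip

variable {F : ℝ × ℝ × ℝ → ℝ}

theorem ContDiffOn.hasFDerivAt_openStrip (hF : ContDiffOn ℝ 1 F closedStrip) {p : ℝ × ℝ × ℝ}
    (hp : p ∈ openStrip) : HasFDerivAt F (fderivWithin ℝ F closedStrip p) p :=
  ((hF.differentiableOn one_ne_zero p
    (openStrip_subset_closedStrip hp)).hasFDerivWithinAt).hasFDerivAt (closedStrip_mem_nhds hp)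

theorem integrableOn_fderivWithin_closedStrip (hF : ContDiffOn ℝ 1 F closedStrip) {K : ℝ}
    (hK : ∀ p, F p ≠ 0 → |p.1| ≤ K ∧ |p.2.1| ≤ K) (v : ℝ × ℝ × ℝ) :
    IntegrableOn (fun p => fderivWithin ℝ F closedStrip p v) openStrip := by
  have hc : ContinuousOn (fun p => fderivWithin ℝ F closedStrip p v) closedStrip :=
    (hF.continuousOn_fderivWithin uniqueDiffOn_closedStrip le_rfl).clm_apply continuousOn_const
  have hcpt : IsCompact (Icc (-K) K ×ˢ (Icc (-K) K ×ˢ Icc (-1 : ℝ) 0)) :=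
    isCompact_Icc.prod (isCompact_Icc.prod isCompact_Icc)
  have hsub : Icc (-K) K ×ˢ (Icc (-K) K ×ˢ Icc (-1 : ℝ) 0) ⊆ closedStrip := fun p hp => hp.2.2
  refine ((hc.mono hsub).integrableOn_compact hcpt).of_forall_sdiff_eq_zero
    isOpen_openStrip.measurableSet fun p hp => ?_
  have hclosed : IsClosed {q : ℝ × ℝ × ℝ | |q.1| ≤ K ∧ |q.2.1| ≤ K} := by
    rw [ofPred_and]
    exact (isClosed_le (by fun_prop) (by fun_prop)).inter
      (isClosed_le (by fun_prop) (by fun_prop))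
  have hpn : p ∉ {q : ℝ × ℝ × ℝ | |q.1| ≤ K ∧ |q.2.1| ≤ K} := fun h =>
    hp.2 ⟨abs_le.1 h.1, abs_le.1 h.2, openStrip_subset_closedStrip hp.1⟩
  have hev : F =ᶠ[nhds p] fun _ => 0 := by
    filter_upwards [hclosed.isOpen_compl.mem_nhds hpn] with q hq
    by_contra hne
    exact hq (hK q hne)
  rw [fderivWithin_of_mem_nhds (closedStrip_mem_nhds hp.1), hev.fderiv_eq]
  simp

theorem integral_fderivWithin_line_eq_zero (hF : ContDiffOn ℝ 1 F closedStrip)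
    {l : ℝ → ℝ × ℝ × ℝ} {v : ℝ × ℝ × ℝ} (hl : ContDiff ℝ 1 l) (hv : ∀ t, HasDerivAt l v t)
    (hmem : ∀ t, l t ∈ openStrip) (hsupp : HasCompactSupport (F ∘ l)) :
    ∫ t, fderivWithin ℝ F closedStrip (l t) v = 0 := by
  have hd : ∀ t, HasDerivAt (F ∘ l) (fderivWithin ℝ F closedStrip (l t) v) t := fun t =>
    (hF.hasFDerivAt_openStrip (hmem t)).comp_hasDerivAt t (hv t)
  have hC : ContDiff ℝ 1 (F ∘ l) :=
    hF.comp_contDiff hl fun t => openStrip_subset_closedStrip (hmem t)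
  have hderiv : (fun t => fderivWithin ℝ F closedStrip (l t) v) = deriv (F ∘ l) :=
    funext fun t => (hd t).deriv.symm
  refine integral_eq_zero_of_hasDerivAt_of_integrable hd ?_
    (hC.continuous.integrable_of_hasCompactSupport hsupp)
  rw [hderiv]
  exact (hC.continuous_deriv le_rfl).integrable_of_hasCompactSupport hsupp.deriv

theorem integral_fderivWithin_fst_eq_zero (hF : ContDiffOn ℝ 1 F closedStrip) {K : ℝ}
    (hK : ∀ p, F p ≠ 0 → |p.1| ≤ K ∧ |p.2.1| ≤ K) :
    ∫ p in openStrip, fderivWithin ℝ F closedStrip p (1, 0, 0) = 0 := by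
  have hi := integrableOn_fderivWithin_closedStrip hF hK (1, 0, 0)
  rw [openStrip_eq_prod, IntegrableOn, Measure.volume_eq_prod, ← Measure.prod_restrict,
    Measure.restrict_univ] at hi
  rw [openStrip_eq_prod, Measure.volume_eq_prod, ← Measure.prod_restrict, Measure.restrict_univ,
    integral_prod_symm _ hi]
  refine setIntegral_eq_zero_of_forall_eq_zero fun q hq => ?_
  refine integral_fderivWithin_line_eq_zero hF (l := fun t => (t, q)) (by fun_prop)
    (fun t => (hasDerivAt_id t).prodMk (hasDerivAt_const t q)) (fun t => hq.2) ?_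
  refine HasCompactSupport.intro (isCompact_Icc (a := -K) (b := K)) fun t ht => ?_
  by_contra hne
  exact ht (abs_le.1 (hK _ hne).1)

theorem integral_fderivWithin_snd_eq_zero (hF : ContDiffOn ℝ 1 F closedStrip) {K : ℝ}
    (hK : ∀ p, F p ≠ 0 → |p.1| ≤ K ∧ |p.2.1| ≤ K) :
    ∫ p in openStrip, fderivWithin ℝ F closedStrip p (0, 1, 0) = 0 := by
  have hi := integrableOn_fderivWithin_closedStrip hF hK (0, 1, 0)
  rw [openStrip_eq_prod, IntegrableOn, Measure.volume_eq_prod, ← Measure.prod_restrict,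
    Measure.restrict_univ] at hi
  rw [openStrip_eq_prod, Measure.volume_eq_prod, ← Measure.prod_restrict, Measure.restrict_univ,
    integral_prod _ hi]
  refine integral_eq_zero_of_ae ?_
  filter_upwards [hi.prod_right_ae] with x hx
  rw [Measure.volume_eq_prod, ← Measure.prod_restrict, Measure.restrict_univ] at hx ⊢
  rw [integral_prod_symm _ hx]
  refine setIntegral_eq_zero_of_forall_eq_zero fun z hz => ?_
  refine integral_fderivWithin_line_eq_zero hF (l := fun t => (x, t, z)) (by fun_prop)
    (fun t => (hasDerivAt_const t x).prodMk ((hasDerivAt_id t).prodMk (hasDerivAt_const t z)))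
    (fun t => hz) ?_
  refine HasCompactSupport.intro (isCompact_Icc (a := -K) (b := K)) fun t ht => ?_
  by_contra hne
  exact ht (abs_le.1 (hK _ hne).2)

theorem integral_fderivWithin_vertical_eq_zero (hF : ContDiffOn ℝ 1 F closedStrip) {K : ℝ}
    (hK : ∀ p, F p ≠ 0 → |p.1| ≤ K ∧ |p.2.1| ≤ K)
    (hbot : ∀ x y, F (x, y, -1) = 0) (htop : ∀ x y, F (x, y, 0) = 0) :
    ∫ p in openStrip, fderivWithin ℝ F closedStrip p (0, 0, 1) = 0 := by
  have hi := integrableOn_fderivWithin_closedStrip hF hK (0, 0, 1)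
  rw [openStrip_eq_prod, IntegrableOn, Measure.volume_eq_prod, ← Measure.prod_restrict,
    Measure.restrict_univ] at hi
  rw [openStrip_eq_prod, Measure.volume_eq_prod, ← Measure.prod_restrict, Measure.restrict_univ,
    integral_prod _ hi]
  refine integral_eq_zero_of_ae ?_
  filter_upwards [hi.prod_right_ae] with x hx
  rw [Measure.volume_eq_prod, ← Measure.prod_restrict, Measure.restrict_univ] at hx ⊢
  rw [integral_prod _ hx]
  refine integral_eq_zero_of_ae ?_
  filter_upwards [hx.prod_right_ae] with y hy
  rw [restrict_Ioo_eq_restrict_Ioc] at hy ⊢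
  rw [← intervalIntegral.integral_of_le (by norm_num),
    intervalIntegral.integral_eq_sub_of_hasDerivAt_of_le (f := fun t => F (x, y, t)) (by norm_num)
      ?_ ?_ ?_]
  · simp [hbot, htop]
  · exact hF.continuousOn.comp (by fun_prop) fun t ht => ht
  · intro t ht
    have h : HasDerivAt (fun t : ℝ => (x, y, t)) (0, 0, 1) t :=
      (hasDerivAt_const t x).prodMk ((hasDerivAt_const t y).prodMk (hasDerivAt_id t))
    exact (hF.hasFDerivAt_openStrip (p := (x, y, t)) ht).comp_hasDerivAt t h
  · rw [intervalIntegrable_iff_integrableOn_Ioc_of_le (by norm_num)]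
    exact hy

end Strip

/-- The field `(V₁, V₂, w)` is `C¹` on the closed strip, divergence-free and curl-free with respect
to the scaled gradient `(a ∂ₓ, b ∂_y, ∂_z)`, and tangent to the boundary of the strip. -/
structure IsDivCurlFree (a b : ℝ) (V₁ V₂ w : ℝ × ℝ × ℝ → ℝ) : Prop where
  contDiffOn_fst : ContDiffOn ℝ 1 V₁ closedStrip
  contDiffOn_snd : ContDiffOn ℝ 1 V₂ closedStrip
  contDiffOn_vertical : ContDiffOn ℝ 1 w closedStrip
  div_eq_zero : ∀ p ∈ openStrip,
    a * fderivWithin ℝ V₁ closedStrip p (1, 0, 0) + b * fderivWithin ℝ V₂ closedStrip p (0, 1, 0)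
      + fderivWithin ℝ w closedStrip p (0, 0, 1) = 0
  curl_fst : ∀ p ∈ openStrip,
    b * fderivWithin ℝ w closedStrip p (0, 1, 0)
      - fderivWithin ℝ V₂ closedStrip p (0, 0, 1) = 0
  curl_snd : ∀ p ∈ openStrip,
    fderivWithin ℝ V₁ closedStrip p (0, 0, 1)
      - a * fderivWithin ℝ w closedStrip p (1, 0, 0) = 0
  curl_vertical : ∀ p ∈ openStrip,
    a * fderivWithin ℝ V₂ closedStrip p (1, 0, 0)
      - b * fderivWithin ℝ V₁ closedStrip p (0, 1, 0) = 0
  bot : ∀ x y : ℝ, w (x, y, -1) = 0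
  top : ∀ x y : ℝ, w (x, y, 0) = 0

namespace IsDivCurlFree

variable {a b : ℝ} {V₁ V₂ w : ℝ × ℝ × ℝ → ℝ}

/-- Pohozaev-type identity: the stress tensor of a divergence-free and curl-free field is
divergence-free, and is tested here against a compactly supported horizontal vector field. -/
theorem integral_stress_eq_zero (h : IsDivCurlFree a b V₁ V₂ w) {X Y : ℝ × ℝ × ℝ → ℝ}
    (hX : ContDiff ℝ 1 X) (hY : ContDiff ℝ 1 Y) {K : ℝ}
    (hXK : ∀ p, X p ≠ 0 → |p.1| ≤ K ∧ |p.2.1| ≤ K)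
    (hYK : ∀ p, Y p ≠ 0 → |p.1| ≤ K ∧ |p.2.1| ≤ K)
    (hXz : ∀ p, fderiv ℝ X p (0, 0, 1) = 0) (hYz : ∀ p, fderiv ℝ Y p (0, 0, 1) = 0) :
    ∫ p in openStrip, ((V₁ p * V₁ p - V₂ p * V₂ p - w p * w p) / 2
        * (a * fderiv ℝ X p (1, 0, 0))
      + V₁ p * V₂ p * (a * fderiv ℝ Y p (1, 0, 0) + b * fderiv ℝ X p (0, 1, 0))
      + (V₂ p * V₂ p - V₁ p * V₁ p - w p * w p) / 2 * (b * fderiv ℝ Y p (0, 1, 0))) = 0 := by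
  obtain ⟨hV₁, hV₂, hw, hdiv, hc₁, hc₂, hc₃, hbot, htop⟩ := h
  set F₁ : ℝ × ℝ × ℝ → ℝ := fun p =>
    (V₁ p * V₁ p - V₂ p * V₂ p - w p * w p) * (1 / 2) * X p + V₁ p * V₂ p * Y p with hF₁
  set F₂ : ℝ × ℝ × ℝ → ℝ := fun p =>
    V₁ p * V₂ p * X p + (V₂ p * V₂ p - V₁ p * V₁ p - w p * w p) * (1 / 2) * Y p with hF₂
  set F₃ : ℝ × ℝ × ℝ → ℝ := fun p => w p * (V₁ p * X p + V₂ p * Y p) with hF₃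
  have hF₁C : ContDiffOn ℝ 1 F₁ closedStrip := by
    have := hX.contDiffOn (s := closedStrip)
    have := hY.contDiffOn (s := closedStrip)
    fun_prop
  have hF₂C : ContDiffOn ℝ 1 F₂ closedStrip := by
    have := hX.contDiffOn (s := closedStrip)
    have := hY.contDiffOn (s := closedStrip)
    fun_prop
  have hF₃C : ContDiffOn ℝ 1 F₃ closedStrip := by
    have := hX.contDiffOn (s := closedStrip)
    have := hY.contDiffOn (s := closedStrip)
    fun_prop
  have hsupp : ∀ p, X p ≠ 0 ∨ Y p ≠ 0 → |p.1| ≤ K ∧ |p.2.1| ≤ K := fun p hp =>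
    hp.elim (hXK p) (hYK p)
  have hF₁K : ∀ p, F₁ p ≠ 0 → |p.1| ≤ K ∧ |p.2.1| ≤ K := fun p hp => hsupp p <| by
    contrapose! hp; simp [hF₁, hp.1, hp.2]
  have hF₂K : ∀ p, F₂ p ≠ 0 → |p.1| ≤ K ∧ |p.2.1| ≤ K := fun p hp => hsupp p <| by
    contrapose! hp; simp [hF₂, hp.1, hp.2]
  have hF₃K : ∀ p, F₃ p ≠ 0 → |p.1| ≤ K ∧ |p.2.1| ≤ K := fun p hp => hsupp p <| by
    contrapose! hp; simp [hF₃, hp.1, hp.2]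
  have hI₁ := integral_fderivWithin_fst_eq_zero hF₁C hF₁K
  have hI₂ := integral_fderivWithin_snd_eq_zero hF₂C hF₂K
  have hI₃ := integral_fderivWithin_vertical_eq_zero hF₃C hF₃K (by simp [hF₃, hbot])
    (by simp [hF₃, htop])
  have hi₁ := integrableOn_fderivWithin_closedStrip hF₁C hF₁K (1, 0, 0)
  have hi₂ := integrableOn_fderivWithin_closedStrip hF₂C hF₂K (0, 1, 0)
  have hi₃ := integrableOn_fderivWithin_closedStrip hF₃C hF₃K (0, 0, 1)
  have hsum : ∫ p in openStrip, (a * fderivWithin ℝ F₁ closedStrip p (1, 0, 0)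
      + b * fderivWithin ℝ F₂ closedStrip p (0, 1, 0)
      + fderivWithin ℝ F₃ closedStrip p (0, 0, 1)) = 0 := by
    have hi₁₂ : IntegrableOn (fun p => a * fderivWithin ℝ F₁ closedStrip p (1, 0, 0)
      + b * fderivWithin ℝ F₂ closedStrip p (0, 1, 0)) openStrip :=
      (hi₁.const_mul a).add (hi₂.const_mul b)
    rw [integral_add hi₁₂ hi₃, integral_add (hi₁.const_mul a) (hi₂.const_mul b), integral_const_mul, integral_const_mul,
      hI₁, hI₂, hI₃]
    simp
  refine Eq.trans ?_ hsum
  refine setIntegral_congr_fun isOpen_openStrip.measurableSet fun p hp => ?_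
  have dV₁ := hV₁.hasFDerivAt_openStrip hp
  have dV₂ := hV₂.hasFDerivAt_openStrip hp
  have dw := hw.hasFDerivAt_openStrip hp
  have dX := (hX.differentiable one_ne_zero p).hasFDerivAt
  have dY := (hY.differentiable one_ne_zero p).hasFDerivAt
  have dF₁ := ((((dV₁.mul dV₁).sub (dV₂.mul dV₂)).sub (dw.mul dw)).mul_const (1 / 2 : ℝ)).mul dX
    |>.add ((dV₁.mul dV₂).mul dY)
  have dF₂ := ((dV₁.mul dV₂).mul dX).add
    (((((dV₂.mul dV₂).sub (dV₁.mul dV₁)).sub (dw.mul dw)).mul_const (1 / 2 : ℝ)).mul dY)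
  have dF₃ := dw.mul ((dV₁.mul dX).add (dV₂.mul dY))
  have e₁ := (hF₁C.hasFDerivAt_openStrip hp).unique dF₁
  have e₂ := (hF₂C.hasFDerivAt_openStrip hp).unique dF₂
  have e₃ := (hF₃C.hasFDerivAt_openStrip hp).unique dF₃
  have hXz' := hXz p
  have hYz' := hYz p
  have hdiv' := hdiv p hp
  have hc₁' := hc₁ p hp
  have hc₂' := hc₂ p hp
  have hc₃' := hc₃ p hp
  simp only [e₁, e₂, e₃, add_apply, sub_apply,
    smul_apply, smul_eq_mul, Pi.mul_apply, Pi.sub_apply, Pi.add_apply]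
  linear_combination (-(V₁ p * X p + V₂ p * Y p)) * hdiv' - (V₁ p * Y p - V₂ p * X p) * hc₃'
    - w p * X p * hc₂' + w p * Y p * hc₁' - w p * V₁ p * hXz' - w p * V₂ p * hYz'

end IsDivCurlFree

theorem exists_cutoff : ∃ (χ : ℝ → ℝ) (K : ℝ), ContDiff ℝ 1 χ ∧ HasCompactSupport χ ∧ χ 0 = 1 ∧
    ∀ t, χ t ≠ 0 → |t| ≤ K := by
  obtain ⟨χ, -, hc, hd, -, h0⟩ :=
    exists_contDiff_tsupport_subset (E := ℝ) (x := 0) (n := 1) Filter.univ_mem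
  obtain ⟨K, hK⟩ := hc.isCompact.isBounded.exists_norm_le
  exact ⟨χ, K, hd, hc, h0, fun t ht => hK t (subset_tsupport χ ht)⟩

theorem HasCompactSupport.exists_abs_le {g : ℝ → ℝ} (hc : HasCompactSupport g)
    (hg : Continuous g) : ∃ M, ∀ t, |g t| ≤ M :=
  hg.bounded_above_of_compact_support hc

theorem fderiv_mul_comp_scaled_apply {f g : ℝ → ℝ} (hf : Differentiable ℝ f) (hg : Differentiable ℝ g)
    (ε c : ℝ) (p : ℝ × ℝ × ℝ) (v : ℝ × ℝ × ℝ) :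
    fderiv ℝ (fun q : ℝ × ℝ × ℝ => f (ε * q.1) * g (ε * q.2.1) * c) p v =
      c * ε * (deriv f (ε * p.1) * g (ε * p.2.1) * v.1
        + f (ε * p.1) * deriv g (ε * p.2.1) * v.2.1) := by
  have hx : HasFDerivAt (fun q : ℝ × ℝ × ℝ => q.1) (ContinuousLinearMap.fst ℝ ℝ (ℝ × ℝ)) p :=
    hasFDerivAt_fst
  have hy : HasFDerivAt (fun q : ℝ × ℝ × ℝ => q.2.1)
      ((ContinuousLinearMap.fst ℝ ℝ ℝ).comp (ContinuousLinearMap.snd ℝ ℝ (ℝ × ℝ))) p :=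
    hasFDerivAt_fst.comp p hasFDerivAt_snd
  have h1 : HasFDerivAt (fun q : ℝ × ℝ × ℝ => f (ε * q.1)) _ p :=
    (hf _).hasDerivAt.comp_hasFDerivAt p (hx.const_mul ε)
  have h2 : HasFDerivAt (fun q : ℝ × ℝ × ℝ => g (ε * q.2.1)) _ p :=
    (hg _).hasDerivAt.comp_hasFDerivAt p (hy.const_mul ε)
  have h3 : HasFDerivAt (fun q : ℝ × ℝ × ℝ => f (ε * q.1) * g (ε * q.2.1) * c) _ p :=
    (h1.mul h2).mul_const c
  rw [h3.fderiv]
  simp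
  ring

namespace IsDivCurlFree

variable {a b : ℝ} {V₁ V₂ w : ℝ × ℝ × ℝ → ℝ}

theorem integral_cutoff_eq_zero (h : IsDivCurlFree a b V₁ V₂ w) (ha : a ≠ 0) (hb : b ≠ 0)
    {φ χ : ℝ → ℝ} (hφ : ContDiff ℝ 1 φ) (hχ : ContDiff ℝ 1 χ) {K : ℝ}
    (hφK : ∀ t, φ t ≠ 0 → |t| ≤ K) (hχK : ∀ t, χ t ≠ 0 → |t| ≤ K) {ε : ℝ} (hε : 0 < ε) :
    ∫ p in openStrip, ((V₁ p * V₁ p - V₂ p * V₂ p - w p * w p) / 2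
        * (deriv φ (ε * p.1) * χ (ε * p.2.1))
      + V₁ p * V₂ p * (a / b * (deriv χ (ε * p.1) * φ (ε * p.2.1))
        + b / a * (φ (ε * p.1) * deriv χ (ε * p.2.1)))
      + (V₂ p * V₂ p - V₁ p * V₁ p - w p * w p) / 2
        * (χ (ε * p.1) * deriv φ (ε * p.2.1))) = 0 := by
  have hscale : ∀ t, |ε * t| ≤ K → |t| ≤ K / ε := fun t ht => by
    rw [abs_mul, abs_of_pos hε] at ht
    rwa [le_div_iff₀' hε]
  have dφ := hφ.differentiable one_ne_zero
  have dχ := hχ.differentiable one_ne_zero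
  have key := h.integral_stress_eq_zero
    (X := fun p => φ (ε * p.1) * χ (ε * p.2.1) * (ε * a)⁻¹)
    (Y := fun p => χ (ε * p.1) * φ (ε * p.2.1) * (ε * b)⁻¹) (K := K / ε)
    (by fun_prop) (by fun_prop)
    (fun p hp => ⟨hscale _ (hφK _ fun h0 => hp (by simp [h0])),
      hscale _ (hχK _ fun h0 => hp (by simp [h0]))⟩)
    (fun p hp => ⟨hscale _ (hχK _ fun h0 => hp (by simp [h0])),
      hscale _ (hφK _ fun h0 => hp (by simp [h0]))⟩)
    (fun p => by rw [fderiv_mul_comp_scaled_apply dφ dχ]; simp)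
    (fun p => by rw [fderiv_mul_comp_scaled_apply dχ dφ]; simp)
  rw [← key]
  congr 1
  funext p
  simp only [fderiv_mul_comp_scaled_apply dφ dχ, fderiv_mul_comp_scaled_apply dχ dφ]
  field_simp
  ring

theorem vertical_eqOn_zero (h : IsDivCurlFree a b V₁ V₂ w) (ha : a ≠ 0) (hb : b ≠ 0)
    (hL2 : IntegrableOn (fun p => V₁ p ^ 2 + V₂ p ^ 2 + w p ^ 2) openStrip) :
    EqOn w 0 openStrip := by
  obtain ⟨χ, K, hχ, hχc, hχ0, hχK⟩ := exists_cutoff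
  set φ : ℝ → ℝ := fun t => t * χ t with hφdef
  have hφ : ContDiff ℝ 1 φ := contDiff_id.mul hχ
  have hφc : HasCompactSupport φ := hχc.mul_left
  have hφK : ∀ t, φ t ≠ 0 → |t| ≤ K := fun t ht => hχK t (right_ne_zero_of_mul ht)
  have hφ'0 : deriv φ 0 = 1 := by
    have : HasDerivAt φ _ 0 :=
      (hasDerivAt_id (0 : ℝ)).mul (hχ.differentiable one_ne_zero 0).hasDerivAt
    simpa [hχ0] using this.deriv
  have hφ' := hφ.continuous_deriv le_rfl
  have hχ' := hχ.continuous_deriv le_rfl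
  obtain ⟨M₁, hM₁⟩ := hχc.exists_abs_le hχ.continuous
  obtain ⟨M₂, hM₂⟩ := hφc.exists_abs_le hφ.continuous
  obtain ⟨M₃, hM₃⟩ := hχc.deriv.exists_abs_le hχ'
  obtain ⟨M₄, hM₄⟩ := hφc.deriv.exists_abs_le hφ'
  have cV₁ := h.contDiffOn_fst.continuousOn.mono openStrip_subset_closedStrip
  have cV₂ := h.contDiffOn_snd.continuousOn.mono openStrip_subset_closedStrip
  have cw := h.contDiffOn_vertical.continuousOn.mono openStrip_subset_closedStrip
  set G : ℝ → ℝ × ℝ × ℝ → ℝ := fun ε p => (V₁ p * V₁ p - V₂ p * V₂ p - w p * w p) / 2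
        * (deriv φ (ε * p.1) * χ (ε * p.2.1))
      + V₁ p * V₂ p * (a / b * (deriv χ (ε * p.1) * φ (ε * p.2.1))
        + b / a * (φ (ε * p.1) * deriv χ (ε * p.2.1)))
      + (V₂ p * V₂ p - V₁ p * V₁ p - w p * w p) / 2
        * (χ (ε * p.1) * deriv φ (ε * p.2.1)) with hG
  have hG0 : ∀ p, G 0 p = -(w p ^ 2) := fun p => by
    simp only [hG, zero_mul, hχ0, hφ'0]
    simp only [hφdef, zero_mul]
    ring
  have hcont : ContinuousWithinAt (fun ε => ∫ p in openStrip, G ε p) (Ioi 0) 0 := by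
    refine continuousWithinAt_of_dominated (bound := fun p =>
      (V₁ p ^ 2 + V₂ p ^ 2 + w p ^ 2) *
        (M₄ * M₁ + (|a / b| * (M₃ * M₂) + |b / a| * (M₂ * M₃)) + M₁ * M₄)) ?_ ?_
      (hL2.mul_const _) ?_
    · refine Filter.Eventually.of_forall fun ε => ?_
      refine ContinuousOn.aestronglyMeasurable ?_ isOpen_openStrip.measurableSet
      have := hχ.continuous
      have := hφ.continuous
      simp only [hG]
      fun_prop
    · refine Filter.Eventually.of_forall fun ε => Filter.Eventually.of_forall fun p => ?_
      have hmul : ∀ {x y A B : ℝ}, |x| ≤ A → |y| ≤ B → |x * y| ≤ A * B := fun hx hy => by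
        rw [abs_mul]
        exact mul_le_mul hx hy (abs_nonneg _) ((abs_nonneg _).trans hx)
      have t₁ : |(V₁ p * V₁ p - V₂ p * V₂ p - w p * w p) / 2| ≤
          V₁ p ^ 2 + V₂ p ^ 2 + w p ^ 2 := by
        rw [abs_le]; constructor <;> nlinarith [sq_nonneg (V₁ p), sq_nonneg (V₂ p), sq_nonneg (w p)]
      have t₂ : |(V₂ p * V₂ p - V₁ p * V₁ p - w p * w p) / 2| ≤
          V₁ p ^ 2 + V₂ p ^ 2 + w p ^ 2 := by
        rw [abs_le]; constructor <;> nlinarith [sq_nonneg (V₁ p), sq_nonneg (V₂ p), sq_nonneg (w p)]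
      have t₃ : |V₁ p * V₂ p| ≤ V₁ p ^ 2 + V₂ p ^ 2 + w p ^ 2 := by
        rw [abs_le]; constructor <;>
          nlinarith [sq_nonneg (V₁ p + V₂ p), sq_nonneg (V₁ p - V₂ p), sq_nonneg (w p),
            sq_nonneg (V₁ p), sq_nonneg (V₂ p)]
      rw [Real.norm_eq_abs, mul_add, mul_add]
      refine (abs_add_le _ _).trans (add_le_add ((abs_add_le _ _).trans (add_le_add ?_ ?_)) ?_)
      · exact hmul t₁ (hmul (hM₄ _) (hM₁ _))
      · exact hmul t₃ ((abs_add_le _ _).trans (add_le_add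
          (hmul le_rfl (hmul (hM₃ _) (hM₂ _))) (hmul le_rfl (hmul (hM₂ _) (hM₃ _)))))
      · exact hmul t₂ (hmul (hM₁ _) (hM₄ _))
    · refine Filter.Eventually.of_forall fun p => Continuous.continuousWithinAt ?_
      have := hχ.continuous
      have := hφ.continuous
      simp only [hG]
      fun_prop
  have hzero : ∫ p in openStrip, G 0 p = 0 := by
    refine tendsto_nhds_unique hcont (tendsto_const_nhds.congr' ?_)
    filter_upwards [self_mem_nhdsWithin] with ε hε
    exact (h.integral_cutoff_eq_zero ha hb hφ hχ hφK hχK hε).symm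
  simp only [hG0, integral_neg, neg_eq_zero] at hzero
  have hint : IntegrableOn (fun p => w p ^ 2) openStrip := by
    refine hL2.mono' ((cw.pow 2).aestronglyMeasurable isOpen_openStrip.measurableSet)
      (Filter.Eventually.of_forall fun p => ?_)
    rw [Real.norm_of_nonneg (sq_nonneg _)]
    nlinarith [sq_nonneg (V₁ p), sq_nonneg (V₂ p)]
  have hae := (setIntegral_eq_zero_iff_of_nonneg_ae
    (Filter.Eventually.of_forall fun p => sq_nonneg (w p)) hint).1 hzero
  have := Measure.eqOn_open_of_ae_eq hae isOpen_openStrip (cw.pow 2) continuousOn_const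
  exact fun p hp => pow_eq_zero_iff two_ne_zero |>.1 (this hp)

end IsDivCurlFree

/-- The real-linear change of coordinates `(ζ, z) ↦ (a re ζ, b im ζ, z)`. -/
noncomputable def complexScaling (a b : ℝ) (ha : a ≠ 0) (hb : b ≠ 0) :
    (ℂ × ℝ) ≃L[ℝ] ℝ × ℝ × ℝ :=
  LinearEquiv.toContinuousLinearEquiv
    { toFun := fun q => (a * q.1.re, b * q.1.im, q.2)
      invFun := fun p => (⟨p.1 / a, p.2.1 / b⟩, p.2.2)
      map_add' := fun p q => by simp [mul_add]
      map_smul' := fun c q => by simp [mul_left_comm]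
      left_inv := fun q => by simp [ha, hb]
      right_inv := fun p => by simp [mul_div_cancel₀, ha, hb] }

theorem complexScaling_apply {a b : ℝ} (ha : a ≠ 0) (hb : b ≠ 0) (q : ℂ × ℝ) :
    complexScaling a b ha hb q = (a * q.1.re, b * q.1.im, q.2) := rfl

theorem MeasureTheory.Integrable.comp_continuousLinearEquiv {E F : Type*}
    [NormedAddCommGroup E] [NormedSpace ℝ E] [FiniteDimensional ℝ E] [MeasurableSpace E]
    [BorelSpace E] [NormedAddCommGroup F] [NormedSpace ℝ F] [FiniteDimensional ℝ F]
    [MeasurableSpace F] [BorelSpace F] {μ : Measure E} [μ.IsAddHaarMeasure] {ν : Measure F}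
    [ν.IsAddHaarMeasure] {g : F → ℝ} (hg : Integrable g ν) (L : E ≃L[ℝ] F) :
    Integrable (g ∘ L) μ := by
  have hL : (μ.map L).IsAddHaarMeasure := L.isAddHaarMeasure_map μ
  refine (integrable_map_equiv L.toHomeomorph.toMeasurableEquiv g).1 ?_
  change Integrable g (μ.map L)
  rw [Measure.isAddLeftInvariant_eq_smul (μ.map L) ν]
  exact hg.smul_measure_nnreal

namespace IsDivCurlFree

variable {a b : ℝ} {V₁ V₂ w : ℝ × ℝ × ℝ → ℝ}

theorem differentiable_complex (h : IsDivCurlFree a b V₁ V₂ w) (hw : EqOn w 0 openStrip) {z : ℝ}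
    (hz : z ∈ Ioo (-1 : ℝ) 0) :
    Differentiable ℂ fun ζ : ℂ => (V₁ (a * ζ.re, b * ζ.im, z) : ℂ)
      - V₂ (a * ζ.re, b * ζ.im, z) * Complex.I := by
  intro ζ
  have hp : (a * ζ.re, b * ζ.im, z) ∈ openStrip := hz
  have hl : HasFDerivAt (fun ζ : ℂ => (a * ζ.re, b * ζ.im, z))
      ((a • Complex.reCLM).prod ((b • Complex.imCLM).prod (0 : ℂ →L[ℝ] ℝ))) ζ :=
    (Complex.reCLM.hasFDerivAt.const_mul a).prodMk
      ((Complex.imCLM.hasFDerivAt.const_mul b).prodMk (hasFDerivAt_const z ζ))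
  have d₁ := Complex.ofRealCLM.hasFDerivAt.comp ζ
    ((h.contDiffOn_fst.hasFDerivAt_openStrip hp).comp ζ hl)
  have d₂ := (Complex.ofRealCLM.hasFDerivAt.comp ζ
    ((h.contDiffOn_snd.hasFDerivAt_openStrip hp).comp ζ hl)).mul_const Complex.I
  have d := d₁.sub d₂
  have hwz : fderivWithin ℝ w closedStrip (a * ζ.re, b * ζ.im, z) (0, 0, 1) = 0 := by
    have hev : w =ᶠ[nhds (a * ζ.re, b * ζ.im, z)] fun _ => 0 :=
      Filter.eventually_of_mem (isOpen_openStrip.mem_nhds hp) hw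
    rw [fderivWithin_of_mem_nhds (closedStrip_mem_nhds hp), hev.fderiv_eq]
    simp
  have hdiv := h.div_eq_zero _ hp
  have hcurl := h.curl_vertical _ hp
  rw [hwz, add_zero] at hdiv
  refine differentiableAt_complex_iff_differentiableAt_real.2 ⟨d.differentiableAt, ?_⟩
  have hx : ∀ T : ℝ × ℝ × ℝ →L[ℝ] ℝ, T (a, 0, 0) = a * T (1, 0, 0) := fun T => by
    rw [← smul_eq_mul, ← map_smul]; simp
  have hy : ∀ T : ℝ × ℝ × ℝ →L[ℝ] ℝ, T (0, b, 0) = b * T (0, 1, 0) := fun T => by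
    rw [← smul_eq_mul, ← map_smul]; simp
  refine (congrArg (fun T : ℂ →L[ℝ] ℂ => T Complex.I = Complex.I • T 1) d.fderiv).mpr ?_
  apply Complex.ext
  · simp [hx, hy]
    linarith
  · simp [hx, hy]
    linarith

theorem horizontal_eq_zero_of_integrable (h : IsDivCurlFree a b V₁ V₂ w)
    (hw : EqOn w 0 openStrip) {z : ℝ} (hz : z ∈ Ioo (-1 : ℝ) 0)
    (hi : Integrable fun ζ : ℂ => V₁ (a * ζ.re, b * ζ.im, z) ^ 2
      + V₂ (a * ζ.re, b * ζ.im, z) ^ 2) (ζ : ℂ) :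
    V₁ (a * ζ.re, b * ζ.im, z) = 0 ∧ V₂ (a * ζ.re, b * ζ.im, z) = 0 := by
  set f : ℂ → ℂ := fun ζ => (V₁ (a * ζ.re, b * ζ.im, z) : ℂ)
      - V₂ (a * ζ.re, b * ζ.im, z) * Complex.I with hf
  have hd : Differentiable ℂ f := h.differentiable_complex hw hz
  have hnorm : ∀ ζ, ‖f ζ ^ 2‖ = V₁ (a * ζ.re, b * ζ.im, z) ^ 2
      + V₂ (a * ζ.re, b * ζ.im, z) ^ 2 := fun ζ => by
    rw [norm_pow, ← Complex.normSq_eq_norm_sq, Complex.normSq_apply]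
    simp [hf]
    ring
  have hzero : (fun ζ => f ζ ^ 2) = 0 := (hd.pow 2).eq_zero_of_integrable <|
    (integrable_norm_iff (hd.pow 2).continuous.aestronglyMeasurable).1 <| by
      simpa only [Pi.pow_apply, hnorm] using hi
  have h0 := hnorm ζ
  rw [congrFun hzero ζ, Pi.zero_apply, norm_zero] at h0
  constructor <;> nlinarith [sq_nonneg (V₁ (a * ζ.re, b * ζ.im, z)),
    sq_nonneg (V₂ (a * ζ.re, b * ζ.im, z))]

theorem eq_zero (h : IsDivCurlFree a b V₁ V₂ w) (ha : a ≠ 0) (hb : b ≠ 0)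
    (hL2 : IntegrableOn (fun p => V₁ p ^ 2 + V₂ p ^ 2 + w p ^ 2) openStrip) :
    ∀ p ∈ openStrip, V₁ p = 0 ∧ V₂ p = 0 ∧ w p = 0 := by
  have hw := h.vertical_eqOn_zero ha hb hL2
  have hv₂ : (volume : Measure (ℝ × ℝ)).IsAddHaarMeasure := by
    rw [Measure.volume_eq_prod]; infer_instance
  have hv₃ : (volume : Measure (ℝ × ℝ × ℝ)).IsAddHaarMeasure := by
    rw [Measure.volume_eq_prod]; infer_instance
  have hi := ((integrable_indicator_iff isOpen_openStrip.measurableSet).2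
    hL2).comp_continuousLinearEquiv (μ := (volume : Measure ℂ).prod (volume : Measure ℝ))
      (complexScaling a b ha hb)
  have hae : ∀ᵐ z : ℝ, z ∈ Ioo (-1 : ℝ) 0 → ∀ ζ : ℂ,
      V₁ (a * ζ.re, b * ζ.im, z) = 0 ∧ V₂ (a * ζ.re, b * ζ.im, z) = 0 := by
    filter_upwards [hi.prod_left_ae] with z hint hz
    refine h.horizontal_eq_zero_of_integrable hw hz (hint.congr (.of_forall fun ζ => ?_))
    have hp : (a * ζ.re, b * ζ.im, z) ∈ openStrip := hz
    simp [complexScaling_apply, hp, hw hp]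
  rintro ⟨x, y, z⟩ hp
  have hline : ∀ {V : ℝ × ℝ × ℝ → ℝ}, ContDiffOn ℝ 1 V closedStrip →
      (∀ᵐ t : ℝ, t ∈ Ioo (-1 : ℝ) 0 → V (x, y, t) = 0) → V (x, y, z) = 0 := fun hV hV0 =>
    Measure.eqOn_open_of_ae_eq (U := Ioo (-1 : ℝ) 0) (g := fun _ => 0)
      ((ae_restrict_iff' measurableSet_Ioo).2 hV0) isOpen_Ioo
      (hV.continuousOn.comp (by fun_prop) fun t ht => Ioo_subset_Icc_self ht)
      continuousOn_const hp
  have hxy : ∀ᵐ t : ℝ, t ∈ Ioo (-1 : ℝ) 0 → V₁ (x, y, t) = 0 ∧ V₂ (x, y, t) = 0 := by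
    filter_upwards [hae] with t ht hmem
    simpa [mul_div_cancel₀, ha, hb] using ht hmem ⟨x / a, y / b⟩
  refine ⟨hline h.contDiffOn_fst ?_, hline h.contDiffOn_snd ?_, hw hp⟩
  · filter_upwards [hxy] with t ht hmem using (ht hmem).1
  · filter_upwards [hxy] with t ht hmem using (ht hmem).2

end IsDivCurlFree

/-- Uniqueness for the div-curl problem on the flat strip in horizontal
dimension `d = 2` (rigid lid model). -/
theorem div_curl_uniqueness_dim2
    (μ γ : ℝ) (hμ : 0 < μ) (hγ : 0 < γ) (hγ1 : γ ≤ 1)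
    (V₁ V₂ w : ℝ × ℝ × ℝ → ℝ)
    (S Scl : Set (ℝ × ℝ × ℝ))
    (hS : S = {p | p.2.2 ∈ Ioo (-1 : ℝ) 0})
    (hScl : Scl = {p | p.2.2 ∈ Icc (-1 : ℝ) 0})
    (hV₁ : ContDiffOn ℝ 1 V₁ Scl)
    (hV₂ : ContDiffOn ℝ 1 V₂ Scl)
    (hw : ContDiffOn ℝ 1 w Scl)
    (hL2 : IntegrableOn (fun p => (V₁ p) ^ 2 + (V₂ p) ^ 2 + (w p) ^ 2) S)
    (hdiv : ∀ p ∈ S,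
      Real.sqrt μ * fderivWithin ℝ V₁ Scl p (1, 0, 0)
        + γ * Real.sqrt μ * fderivWithin ℝ V₂ Scl p (0, 1, 0)
        + fderivWithin ℝ w Scl p (0, 0, 1) = 0)
    (hcurl₁ : ∀ p ∈ S,
      Real.sqrt μ * γ * fderivWithin ℝ w Scl p (0, 1, 0)
        - fderivWithin ℝ V₂ Scl p (0, 0, 1) = 0)
    (hcurl₂ : ∀ p ∈ S,
      fderivWithin ℝ V₁ Scl p (0, 0, 1)
        - Real.sqrt μ * fderivWithin ℝ w Scl p (1, 0, 0) = 0)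
    (hcurl₃ : ∀ p ∈ S,
      Real.sqrt μ * fderivWithin ℝ V₂ Scl p (1, 0, 0)
        - Real.sqrt μ * γ * fderivWithin ℝ V₁ Scl p (0, 1, 0) = 0)
    (hbot : ∀ x y : ℝ, w (x, y, -1) = 0)
    (htop : ∀ x y : ℝ, w (x, y, 0) = 0) :
    ∀ p ∈ S, V₁ p = 0 ∧ V₂ p = 0 ∧ w p = 0 := by
  subst hS hScl
  have hs : Real.sqrt μ ≠ 0 := (Real.sqrt_pos.2 hμ).ne'
  have h : IsDivCurlFree (Real.sqrt μ) (γ * Real.sqrt μ) V₁ V₂ w :=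
    { contDiffOn_fst := hV₁
      contDiffOn_snd := hV₂
      contDiffOn_vertical := hw
      div_eq_zero := hdiv
      curl_fst := fun p hp => by rw [mul_comm γ]; exact hcurl₁ p hp
      curl_snd := hcurl₂
      curl_vertical := fun p hp => by rw [mul_comm γ]; exact hcurl₃ p hp
      bot := hbot
      top := htop }
  exact h.eq_zero hs (mul_ne_zero hγ.ne' hs) hL2
end

section
/- Let d ∈ {1, 2}, μ > 0, 0 < γ ≤ 1 and t > 0. For ξ ∈ ℝ^d set |ξ^γ| = |ξ| if d = 1 and |ξ^γ| = sqrt(ξ₁² + γ²ξ₂²) if d = 2, and ω(ξ) = sqrt(|ξ^γ| · tanh(√μ · |ξ^γ|) / √μ). Let F, G : ℝ^d → ℂ be measurable with F square integrable and ω·G square integrable. For ε > 0 define ẑ_ε(ξ) = ((F(ξ) − i ω(ξ) G(ξ))/2) · exp(i ω(ξ) t/ε) + ((F(ξ) + i ω(ξ) G(ξ))/2) · exp(−i ω(ξ) t/ε). Then ∫_{ℝ^d} |ẑ_ε(ξ)|² dξ converges, as ε → 0⁺, to (1/2) ∫_{ℝ^d} ( |F(ξ)|² + ω(ξ)² |G(ξ)|²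 ) dξ. In particular, if (F, ω G) is not zero almost everywhere, the L² norm of ẑ_ε does not tend to 0. -/
open MeasureTheory Filter

/-- The preimage of a Lebesgue null set under an injective function with nonvanishing derivative
is a null set. -/
theorem volume_preimage_inter_eq_zero_of_deriv_ne_zero {f : ℝ → ℝ} {s N : Set ℝ}
    (hs : MeasurableSet s) (hN : MeasurableSet N) (hN0 : volume N = 0) (hf : Measurable f)
    (hinj : Set.InjOn f s) (hd : ∀ x ∈ s, deriv f x ≠ 0) :
    volume (f ⁻¹' N ∩ s) = 0 := by
  have hS : MeasurableSet (f ⁻¹' N ∩ s) := (hf hN).inter hs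
  have key := lintegral_image_eq_lintegral_abs_deriv_mul (f := f) (f' := deriv f) hS
    (fun x hx => (differentiableAt_of_deriv_ne_zero (hd x hx.2)).hasDerivAt.hasDerivWithinAt)
    (hinj.mono Set.inter_subset_right) (fun _ => 1)
  have him : volume (f '' (f ⁻¹' N ∩ s)) = 0 :=
    measure_mono_null (by rintro _ ⟨x, hx, rfl⟩; exact hx.1) hN0
  simp only [lintegral_const, one_mul, Measure.restrict_apply_univ, him, mul_one] at key
  have hae := (lintegral_eq_zero_iff (measurable_deriv f).abs.ennreal_ofReal).1 key.symm
  rw [Filter.EventuallyEq, ae_restrict_iff' hS] at hae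
  refine measure_eq_zero_iff_ae_notMem.2 (hae.mono fun x hx hxS => ?_)
  have := hx hxS
  simp only [Pi.zero_apply, ENNReal.ofReal_eq_zero] at this
  exact hd x hxS.2 (abs_nonpos_iff.1 this)

/-- The set of vectors whose norm lies in a set of radii that is null on `(0, ∞)` is null. -/
theorem volume_norm_preimage_eq_zero {E : Type*} [NormedAddCommGroup E] [InnerProductSpace ℝ E]
    [FiniteDimensional ℝ E] [MeasurableSpace E] [BorelSpace E] [Nontrivial E]
    {A : Set ℝ} (h : volume (A ∩ Set.Ioi 0) = 0) :
    volume ((fun x : E => ‖x‖) ⁻¹' A) = 0 := by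
  have hzero : (fun y : ℝ => y ^ (Module.finrank ℝ E - 1) • A.indicator (fun _ => (1 : ℝ)) y)
      =ᵐ[volume.restrict (Set.Ioi 0)] 0 := by
    rw [Filter.EventuallyEq, ae_restrict_iff' measurableSet_Ioi]
    filter_upwards [measure_eq_zero_iff_ae_notMem.1 h] with y hy hy0
    have : y ∉ A := fun hyA => hy ⟨hyA, hy0⟩
    simp [this]
  have hint : Integrable (fun x : E => A.indicator (fun _ => (1 : ℝ)) ‖x‖) volume :=
    (integrable_fun_norm_addHaar volume).2
      ((integrable_congr hzero).2 (integrable_zero _ _ _))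
  have hval := integral_fun_norm_addHaar (volume : Measure E)
    (A.indicator (fun _ => (1 : ℝ)))
  rw [integral_congr_ae hzero] at hval
  simp only [Pi.zero_apply, integral_zero, smul_zero] at hval
  have hae := (integral_eq_zero_iff_of_nonneg
    (fun x => Set.indicator_nonneg (fun _ _ => zero_le_one) _) hint).1 hval
  refine measure_eq_zero_iff_ae_notMem.2 (hae.mono fun x hx hxA => ?_)
  have hxA' : ‖x‖ ∈ A := hxA
  simp [hxA'] at hx

/-- **Riemann–Lebesgue lemma** for a phase under which preimages of null sets are null. -/
theorem tendsto_integral_mul_exp_of_quasiMeasurePreserving {α : Type*} [MeasurableSpace α]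
    {m : Measure α} {ω : α → ℝ} (hω : Measure.QuasiMeasurePreserving ω m volume) {f : α → ℝ}
    (hf : Integrable f m) :
    Tendsto (fun l : ℝ => ∫ x, (f x : ℂ) * Complex.exp (Complex.I * ((l * ω x : ℝ) : ℂ)) ∂m)
      atTop (nhds 0) := by
  have hmeas (l : ℝ) : StronglyMeasurable
      fun x => Complex.exp (Complex.I * ((l * x : ℝ) : ℂ)) :=
    Continuous.stronglyMeasurable (by fun_prop)
  have nonneg_case (g : α → ℝ) (hg : Integrable g m) (hg0 : ∀ x, 0 ≤ g x) :
      Tendsto (fun l : ℝ => ∫ x, (g x : ℂ) * Complex.exp (Complex.I * ((l * ω x : ℝ) : ℂ)) ∂m)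
        atTop (nhds 0) := by
    set p := m.withDensity fun x => ENNReal.ofReal (g x) with hp
    have : IsFiniteMeasure p := isFiniteMeasure_withDensity_ofReal hg.2
    set ν := p.map ω with hν
    have hac : ν ≪ volume :=
      ((withDensity_absolutelyContinuous m _).map hω.measurable).trans hω.absolutelyContinuous
    have hRL := (Real.tendsto_integral_exp_smul_cocompact
      (fun x => ((ν.rnDeriv volume x).toReal : ℂ))).comp
      ((tendsto_id.const_mul_atTop_of_neg (r := -(2 * Real.pi)⁻¹)
        (by have := Real.pi_pos; simp [this])).mono_right atBot_le_cocompact)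
    refine hRL.congr fun l => ?_
    have h1 : ∫ x, (g x : ℂ) * Complex.exp (Complex.I * ((l * ω x : ℝ) : ℂ)) ∂m
        = ∫ x, Complex.exp (Complex.I * ((l * ω x : ℝ) : ℂ)) ∂p := by
      rw [hp, integral_withDensity_eq_integral_toReal_smul₀ hg.1.aemeasurable.ennreal_ofReal
        (by simp)]
      refine integral_congr_ae (Eventually.of_forall fun x => ?_)
      simp [ENNReal.toReal_ofReal (hg0 x)]
    have h2 : ∫ x, Complex.exp (Complex.I * ((l * ω x : ℝ) : ℂ)) ∂p
        = ∫ y, Complex.exp (Complex.I * ((l * y : ℝ) : ℂ)) ∂ν :=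
      (integral_map hω.measurable.aemeasurable (hmeas l).aestronglyMeasurable).symm
    rw [h1, h2, ← integral_rnDeriv_smul hac]
    refine integral_congr_ae (Eventually.of_forall fun x => ?_)
    have hπ := Real.pi_ne_zero
    simp only [id, Circle.smul_def, Real.fourierChar_apply, smul_eq_mul,
      Complex.real_smul]
    rw [mul_comm]
    congr 2
    rw [mul_comm]
    congr 2
    field_simp
  have hbound {g : α → ℝ} (hg : Integrable g m) (l : ℝ) : Integrable
      (fun x => (g x : ℂ) * Complex.exp (Complex.I * ((l * ω x : ℝ) : ℂ))) m := by
    refine hg.ofReal.mul_bdd (c := 1)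
      ((hmeas l).comp_measurable hω.measurable).aestronglyMeasurable
      (Eventually.of_forall fun x => ?_)
    rw [mul_comm, Complex.norm_exp_ofReal_mul_I]
  have hsub := (nonneg_case _ hf.pos_part fun x => le_max_right _ _).sub
    (nonneg_case _ hf.neg_part fun x => le_max_right _ _)
  rw [sub_zero] at hsub
  refine hsub.congr fun l => ?_
  rw [← integral_sub (hbound hf.pos_part l) (hbound hf.neg_part l)]
  refine integral_congr_ae (Eventually.of_forall fun x => ?_)
  simp only [← sub_mul, ← Complex.ofReal_sub]
  congr 2
  rcases le_total 0 (f x) with h | h <;> simp [h]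

/-- The dispersion relation of the linearized water-waves equations, as a function of the
modulus of the frequency. -/
noncomputable def waterWavesDispersion (μ r : ℝ) : ℝ :=
  Real.sqrt (r * Real.tanh (Real.sqrt μ * r) / Real.sqrt μ)

theorem continuous_waterWavesDispersion (μ : ℝ) : Continuous (waterWavesDispersion μ) := by
  unfold waterWavesDispersion
  simp_rw [Real.tanh_eq_sinh_div_cosh]
  refine Real.continuous_sqrt.comp (Continuous.div_const (continuous_id.mul ?_) _)
  exact Continuous.div (by fun_prop) (by fun_prop) fun x => (Real.cosh_pos _).ne'

theorem deriv_waterWavesDispersion_pos {μ r : ℝ} (hμ : 0 < μ) (hr : 0 < r) :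
    0 < deriv (waterWavesDispersion μ) r := by
  have hs := Real.sqrt_pos.2 hμ
  set s := Real.sqrt μ with hs_def
  have hc := Real.cosh_pos (s * r)
  have hsr : 0 < s * r := mul_pos hs hr
  have hsh := Real.sinh_pos_iff.2 hsr
  have hlin : HasDerivAt (fun x : ℝ => s * x) s r := by
    simpa using (hasDerivAt_id r).const_mul s
  have hq : HasDerivAt (fun x : ℝ => x * Real.tanh (s * x) / s)
      ((Real.sinh (s * r) / Real.cosh (s * r) + r * (s / Real.cosh (s * r) ^ 2)) / s) r := by
    simp_rw [Real.tanh_eq_sinh_div_cosh]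
    convert! ((hasDerivAt_id r).mul (hlin.sinh.div hlin.cosh hc.ne')).div_const s using 1
    have := Real.cosh_sq (s * r)
    simp only [id, one_mul]
    congr 3
    congr 1
    linear_combination -s * this
  have hqpos : 0 < r * Real.tanh (s * r) / s := by
    rw [Real.tanh_eq_sinh_div_cosh]; positivity
  have hd := hq.sqrt hqpos.ne'
  have : deriv (waterWavesDispersion μ) r = _ := hd.deriv
  rw [this]
  have := Real.sqrt_pos.2 hqpos
  positivity

theorem volume_waterWavesDispersion_preimage_eq_zero {μ : ℝ} (hμ : 0 < μ) {N : Set ℝ}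
    (hN : MeasurableSet N) (hN0 : volume N = 0) :
    volume (waterWavesDispersion μ ⁻¹' N ∩ Set.Ioi 0) = 0 := by
  refine volume_preimage_inter_eq_zero_of_deriv_ne_zero measurableSet_Ioi hN hN0
    (continuous_waterWavesDispersion μ).measurable ?_
    fun x hx => (deriv_waterWavesDispersion_pos hμ hx).ne'
  refine (strictMonoOn_of_deriv_pos (convex_Ioi 0)
    (continuous_waterWavesDispersion μ).continuousOn fun x hx => ?_).injOn
  rw [interior_Ioi] at hx
  exact deriv_waterWavesDispersion_pos hμ hx

/-- The coordinatewise rescaling of Euclidean space by the weights `c`. -/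
noncomputable def diagonalScaling {d : ℕ} (c : Fin d → ℝ) :
    EuclideanSpace ℝ (Fin d) →ₗ[ℝ] EuclideanSpace ℝ (Fin d) where
  toFun ξ := WithLp.toLp 2 fun i => c i * ξ i
  map_add' x y := by ext i; simp [mul_add]
  map_smul' a x := by ext i; simp [mul_left_comm]

theorem det_diagonalScaling_ne_zero {d : ℕ} {c : Fin d → ℝ} (hc : ∀ i, c i ≠ 0) :
    LinearMap.det (diagonalScaling c) ≠ 0 := by
  have hker : LinearMap.ker (diagonalScaling c) = ⊥ := by
    refine LinearMap.ker_eq_bot'.2 fun x hx => ?_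
    ext i
    have := congrArg (fun v : EuclideanSpace ℝ (Fin d) => v i) hx
    simpa [diagonalScaling, hc i] using this
  intro h
  exact (LinearMap.bot_lt_ker_of_det_eq_zero h).ne' hker

theorem norm_diagonalScaling {d : ℕ} (c : Fin d → ℝ) (ξ : EuclideanSpace ℝ (Fin d)) :
    ‖diagonalScaling c ξ‖ = Real.sqrt (∑ i, c i ^ 2 * ξ i ^ 2) := by
  simp [diagonalScaling, EuclideanSpace.norm_eq, mul_pow]

/-- Preimages of null sets under the water-waves dispersion relation, evaluated at an anisotropic
norm of the frequency, are null. -/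
theorem quasiMeasurePreserving_waterWavesDispersion_norm {d : ℕ} (hd : d ≠ 0) {μ : ℝ} (hμ : 0 < μ)
    {c : Fin d → ℝ} (hc : ∀ i, c i ≠ 0) :
    Measure.QuasiMeasurePreserving
      (fun ξ : EuclideanSpace ℝ (Fin d) => waterWavesDispersion μ ‖diagonalScaling c ξ‖)
      volume volume := by
  have : NeZero d := ⟨hd⟩
  have hmeas : Measurable
      (fun ξ : EuclideanSpace ℝ (Fin d) => waterWavesDispersion μ ‖diagonalScaling c ξ‖) :=
    ((continuous_waterWavesDispersion μ).comp
      (LinearMap.continuous_of_finiteDimensional (diagonalScaling c)).norm).measurable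
  refine ⟨hmeas, Measure.AbsolutelyContinuous.mk fun N hN hN0 => ?_⟩
  rw [Measure.map_apply hmeas hN]
  have h1 := volume_norm_preimage_eq_zero (E := EuclideanSpace ℝ (Fin d))
    (volume_waterWavesDispersion_preimage_eq_zero hμ hN hN0)
  have h2 := Measure.addHaar_preimage_linearMap (volume : Measure (EuclideanSpace ℝ (Fin d)))
    (det_diagonalScaling_ne_zero hc)
    ((fun x : EuclideanSpace ℝ (Fin d) => ‖x‖) ⁻¹' (waterWavesDispersion μ ⁻¹' N))
  rw [h1, mul_zero] at h2
  exact h2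

theorem norm_sq_oscillation (a b : ℂ) (θ : ℝ) :
    ‖(a - Complex.I * b) / 2 * Complex.exp (Complex.I * θ)
      + (a + Complex.I * b) / 2 * Complex.exp (-(Complex.I * θ))‖ ^ 2
      = 1 / 2 * (‖a‖ ^ 2 + ‖b‖ ^ 2) + ((‖a‖ ^ 2 - ‖b‖ ^ 2) / 2 * Real.cos (2 * θ)
        + (a.re * b.re + a.im * b.im) * Real.sin (2 * θ)) := by
  have h : (a - Complex.I * b) / 2 * Complex.exp (Complex.I * θ)
      + (a + Complex.I * b) / 2 * Complex.exp (-(Complex.I * θ))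
      = a * (Real.cos θ : ℂ) + b * (Real.sin θ : ℂ) := by
    have e1 : Complex.exp (Complex.I * θ) = Complex.cos θ + Complex.sin θ * Complex.I := by
      rw [mul_comm, Complex.exp_mul_I]
    have e2 : Complex.exp (-(Complex.I * θ)) = Complex.cos θ - Complex.sin θ * Complex.I := by
      rw [mul_comm, ← neg_mul, Complex.exp_mul_I, Complex.cos_neg, Complex.sin_neg]; ring
    rw [e1, e2, Complex.ofReal_cos, Complex.ofReal_sin]
    linear_combination (-b * Complex.sin θ) * Complex.I_sq
  rw [h, Real.cos_two_mul, Real.sin_two_mul]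
  simp only [Complex.sq_norm, Complex.normSq_apply, Complex.add_re, Complex.add_im,
    Complex.re_mul_ofReal, Complex.im_mul_ofReal]
  linear_combination (b.re ^ 2 + b.im ^ 2) * Real.sin_sq_add_cos_sq θ

/-- The `L²` norm of a superposition of two opposite oscillations converges to half the energy, as
the frequency tends to infinity. -/
theorem tendsto_integral_norm_sq_oscillation {α : Type*} [MeasurableSpace α] {m : Measure α}
    {ω : α → ℝ} (hω : Measure.QuasiMeasurePreserving ω m volume) {a b : α → ℂ}
    (ham : Measurable a) (hbm : Measurable b) (ha : Integrable (fun x => ‖a x‖ ^ 2) m)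
    (hb : Integrable (fun x => ‖b x‖ ^ 2) m) :
    Tendsto (fun l : ℝ => ∫ x, ‖(a x - Complex.I * b x) / 2 *
          Complex.exp (Complex.I * ((l * ω x : ℝ) : ℂ))
        + (a x + Complex.I * b x) / 2 * Complex.exp (-(Complex.I * ((l * ω x : ℝ) : ℂ)))‖ ^ 2 ∂m)
      atTop (nhds (1 / 2 * ∫ x, (‖a x‖ ^ 2 + ‖b x‖ ^ 2) ∂m)) := by
  have hP : Integrable (fun x => (‖a x‖ ^ 2 - ‖b x‖ ^ 2) / 2) m := (ha.sub hb).div_const 2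
  have hQ : Integrable (fun x => (a x).re * (b x).re + (a x).im * (b x).im) m := by
    refine (ha.add hb).mono' (by fun_prop) (Eventually.of_forall fun x => ?_)
    simp only [Pi.add_apply, Complex.sq_norm, Complex.normSq_apply, Real.norm_eq_abs]
    rw [abs_le]
    constructor <;>
    nlinarith [sq_nonneg ((a x).re + (b x).re), sq_nonneg ((a x).im + (b x).im),
      sq_nonneg ((a x).re - (b x).re), sq_nonneg ((a x).im - (b x).im),
      mul_self_nonneg (a x).re, mul_self_nonneg (a x).im,
      mul_self_nonneg (b x).re, mul_self_nonneg (b x).im]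
  have hωm := hω.measurable
  have hexp (l : ℝ) {g : α → ℝ} (hg : Integrable g m) : Integrable
      (fun x => (g x : ℂ) * Complex.exp (Complex.I * ((l * ω x : ℝ) : ℂ))) m := by
    refine hg.ofReal.mul_bdd (c := 1) (by fun_prop) (Eventually.of_forall fun x => ?_)
    rw [mul_comm, Complex.norm_exp_ofReal_mul_I]
  have hre (l : ℝ) (g : α → ℝ) (x : α) :
      ((g x : ℂ) * Complex.exp (Complex.I * ((l * ω x : ℝ) : ℂ))).re
        = g x * Real.cos (l * ω x) := by
    rw [Complex.re_ofReal_mul, mul_comm Complex.I, Complex.exp_ofReal_mul_I_re]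
  have him (l : ℝ) (g : α → ℝ) (x : α) :
      ((g x : ℂ) * Complex.exp (Complex.I * ((l * ω x : ℝ) : ℂ))).im
        = g x * Real.sin (l * ω x) := by
    rw [Complex.im_ofReal_mul, mul_comm Complex.I, Complex.exp_ofReal_mul_I_im]
  have hcosint (l : ℝ) {g : α → ℝ} (hg : Integrable g m) :
      Integrable (fun x => g x * Real.cos (l * ω x)) m :=
    (hexp l hg).re.congr (Eventually.of_forall (hre l g))
  have hsinint (l : ℝ) {g : α → ℝ} (hg : Integrable g m) :
      Integrable (fun x => g x * Real.sin (l * ω x)) m :=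
    (hexp l hg).im.congr (Eventually.of_forall (him l g))
  have hcos {g : α → ℝ} (hg : Integrable g m) :
      Tendsto (fun l : ℝ => ∫ x, g x * Real.cos (l * ω x) ∂m) atTop (nhds 0) := by
    have h := (Complex.continuous_re.tendsto 0).comp
      (tendsto_integral_mul_exp_of_quasiMeasurePreserving hω hg)
    refine h.congr fun l => ?_
    simp only [Function.comp, ← hre]
    exact (integral_re (hexp l hg)).symm
  have hsin {g : α → ℝ} (hg : Integrable g m) :
      Tendsto (fun l : ℝ => ∫ x, g x * Real.sin (l * ω x) ∂m) atTop (nhds 0) := by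
    have h := (Complex.continuous_im.tendsto 0).comp
      (tendsto_integral_mul_exp_of_quasiMeasurePreserving hω hg)
    refine h.congr fun l => ?_
    simp only [Function.comp, ← him]
    exact (integral_im (hexp l hg)).symm
  have htwo : Tendsto (fun l : ℝ => 2 * l) atTop atTop :=
    tendsto_id.const_mul_atTop two_pos
  have hlim := (((hcos hP).comp htwo).add ((hsin hQ).comp htwo)).const_add
    (1 / 2 * ∫ x, (‖a x‖ ^ 2 + ‖b x‖ ^ 2) ∂m)
  rw [add_zero, add_zero] at hlim
  refine hlim.congr fun l => ?_
  simp only [norm_sq_oscillation, Function.comp]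
  simp only [← mul_assoc]
  have hE : Integrable (fun x => 1 / 2 * (‖a x‖ ^ 2 + ‖b x‖ ^ 2)) m :=
    (ha.add hb).const_mul _
  have hW : Integrable (fun x => (‖a x‖ ^ 2 - ‖b x‖ ^ 2) / 2 * Real.cos (2 * l * ω x)
      + ((a x).re * (b x).re + (a x).im * (b x).im) * Real.sin (2 * l * ω x)) m :=
    (hcosint _ hP).add (hsinint _ hQ)
  rw [integral_add hE hW, integral_add (hcosint _ hP) (hsinint _ hQ), integral_const_mul]

/-- At any fixed time `t > 0`, the `L²` norm of the Fourier transform of the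
free-surface component of the solution of the linearized water-waves system
in the rigid lid scaling converges, as `ε → 0⁺`, to half the (conserved)
initial energy; in particular it does not tend to `0` unless the initial
data vanishes almost everywhere. -/
theorem linear_ww_L2_norm_limit
    (d : ℕ) (hd : d = 1 ∨ d = 2)
    (μ γ t : ℝ) (hμ : 0 < μ) (hγ : 0 < γ) (hγ1 : γ ≤ 1) (ht : 0 < t)
    (nγ ω : EuclideanSpace ℝ (Fin d) → ℝ)
    (hnγ : ∀ ξ, nγ ξ =
      Real.sqrt (∑ i : Fin d, (if (i : ℕ) = 0 then (1 : ℝ) else γ) ^ 2 * ξ i ^ 2))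
    (hω : ∀ ξ,
      ω ξ = Real.sqrt (nγ ξ * Real.tanh (Real.sqrt μ * nγ ξ) / Real.sqrt μ))
    (F G : EuclideanSpace ℝ (Fin d) → ℂ)
    (hFmeas : Measurable F) (hGmeas : Measurable G)
    (hF : Integrable (fun ξ => ‖F ξ‖ ^ 2))
    (hG : Integrable (fun ξ => ω ξ ^ 2 * ‖G ξ‖ ^ 2))
    (zhat : ℝ → EuclideanSpace ℝ (Fin d) → ℂ)
    (hzhat : ∀ (ε : ℝ) ξ, zhat ε ξ =
      ((F ξ - Complex.I * (ω ξ : ℂ) * G ξ) / 2) *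
          Complex.exp (Complex.I * (ω ξ : ℂ) * (t : ℂ) / (ε : ℂ))
        + ((F ξ + Complex.I * (ω ξ : ℂ) * G ξ) / 2) *
          Complex.exp (-(Complex.I * (ω ξ : ℂ) * (t : ℂ) / (ε : ℂ)))) :
    Tendsto (fun ε : ℝ => ∫ ξ, ‖zhat ε ξ‖ ^ 2)
        (nhdsWithin 0 (Set.Ioi 0))
        (nhds ((1 / 2) * ∫ ξ, (‖F ξ‖ ^ 2 + ω ξ ^ 2 * ‖G ξ‖ ^ 2)))
      ∧ (¬ (∀ᵐ ξ ∂volume, F ξ = 0 ∧ (ω ξ : ℂ) * G ξ = 0) →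
          ¬ Tendsto (fun ε : ℝ => ∫ ξ, ‖zhat ε ξ‖ ^ 2)
              (nhdsWithin 0 (Set.Ioi 0)) (nhds 0)) := by
  set c : Fin d → ℝ := fun i => if (i : ℕ) = 0 then (1 : ℝ) else γ with hc_def
  have hc : ∀ i, c i ≠ 0 := fun i => by
    simp only [hc_def]
    split_ifs
    exacts [one_ne_zero, hγ.ne']
  have hω_eq : ω = fun ξ => waterWavesDispersion μ ‖diagonalScaling c ξ‖ := by
    funext ξ
    rw [hω, hnγ, norm_diagonalScaling, waterWavesDispersion]
  have hqmp : Measure.QuasiMeasurePreserving ω volume volume := by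
    rw [hω_eq]
    exact quasiMeasurePreserving_waterWavesDispersion_norm (by omega) hμ hc
  have hωm := hqmp.measurable
  have hnorm : ∀ ξ, ‖(ω ξ : ℂ) * G ξ‖ ^ 2 = ω ξ ^ 2 * ‖G ξ‖ ^ 2 := fun ξ => by
    rw [norm_mul, mul_pow, Complex.norm_real, Real.norm_eq_abs, sq_abs]
  have hH : Integrable (fun ξ => ‖(ω ξ : ℂ) * G ξ‖ ^ 2) := by simpa only [hnorm] using hG
  have hlim : Tendsto (fun ε : ℝ => ∫ ξ, ‖zhat ε ξ‖ ^ 2) (nhdsWithin 0 (Set.Ioi 0))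
      (nhds ((1 / 2) * ∫ ξ, (‖F ξ‖ ^ 2 + ω ξ ^ 2 * ‖G ξ‖ ^ 2))) := by
    have h := (tendsto_integral_norm_sq_oscillation hqmp hFmeas
      (b := fun ξ => (ω ξ : ℂ) * G ξ) (by fun_prop) hF hH).comp
      (tendsto_inv_nhdsGT_zero.const_mul_atTop ht)
    simp only [hnorm] at h
    refine h.congr fun ε => ?_
    simp only [Function.comp]
    refine integral_congr_ae (Eventually.of_forall fun ξ => ?_)
    have hphase : Complex.I * ((t * ε⁻¹ * ω ξ : ℝ) : ℂ)
        = Complex.I * (ω ξ : ℂ) * (t : ℂ) / (ε : ℂ) := by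
      push_cast
      ring
    simp only [hzhat, hphase, mul_assoc Complex.I (ω ξ : ℂ) (G ξ)]
  refine ⟨hlim, fun hne h0 => hne ?_⟩
  have hzero : ∫ ξ, (‖F ξ‖ ^ 2 + ω ξ ^ 2 * ‖G ξ‖ ^ 2) = 0 := by
    have := tendsto_nhds_unique hlim h0
    linarith
  have hae := (integral_eq_zero_iff_of_nonneg
    (fun ξ => add_nonneg (sq_nonneg ‖F ξ‖) (mul_nonneg (sq_nonneg (ω ξ)) (sq_nonneg ‖G ξ‖)))
    (hF.add hG)).1 hzero
  filter_upwards [hae] with ξ hξ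
  simp only [Pi.zero_apply, ← hnorm] at hξ
  have h1 := sq_nonneg ‖F ξ‖
  have h2 := sq_nonneg ‖(ω ξ : ℂ) * G ξ‖
  exact ⟨norm_eq_zero.1 (pow_eq_zero_iff two_ne_zero |>.1 (by linarith)),
    norm_eq_zero.1 (pow_eq_zero_iff two_ne_zero |>.1 (by linarith))⟩
end

section
/- Let d ∈ {1, 2}, μ > 0, 0 < γ ≤ 1 and t > 0. For ξ ∈ ℝ^d set |ξ^γ| = |ξ| if d = 1 and |ξ^γ| = sqrt(ξ₁² + γ²ξ₂²) if d = 2, and ω(ξ) = sqrt(|ξ^γ| · tanh(√μ · |ξ^γ|) / √μ). Let F, G : ℝ^d → ℂ be measurable with F square integrable and ω·G square integrable, and for ε > 0 define ẑ_ε(ξ) = ((F(ξ) − i ω(ξ) G(ξ))/2) · exp(i ω(ξ) t/ε) + ((F(ξ) + i ω(ξ) G(ξ))/2) · exp(−i ω(ξ) t/ε). Then for every square integrable v : ℝ^d → ℂ, the pairing ∫_{ℝ^d} ẑ_ε(ξ) · conj(v(ξ)) dξ tends to 0 as ε → 0⁺; that is, ẑ_ε converges weakly to zero in L²(ℝ^d).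 -/
open MeasureTheory Filter

/-- A null set of reals has null preimage in `(0, ∞)` under a function with positive derivative. -/
theorem volume_Ioi_inter_preimage_eq_zero {g g' : ℝ → ℝ}
    (hg : ∀ s, 0 < s → HasDerivAt g (g' s) s) (hpos : ∀ s, 0 < s → 0 < g' s)
    (hmeas : Measurable g) {N : Set ℝ} (hN : MeasurableSet N) (hN0 : volume N = 0) :
    volume (Set.Ioi 0 ∩ g ⁻¹' N) = 0 := by
  have hmono : StrictMonoOn g (Set.Ioi 0) := by
    refine strictMonoOn_of_deriv_pos (convex_Ioi 0)
      (fun s hs => (hg s hs).continuousAt.continuousWithinAt) fun s hs => ?_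
    rw [interior_Ioi] at hs
    rw [(hg s hs).deriv]
    exact hpos s hs
  have hS : MeasurableSet (Set.Ioi 0 ∩ g ⁻¹' N) := measurableSet_Ioi.inter (hmeas hN)
  have key := lintegral_image_eq_lintegral_abs_deriv_mul hS
    (fun s hs => (hg s hs.1).hasDerivWithinAt) (hmono.injOn.mono Set.inter_subset_left) 1
  have himage : volume (g '' (Set.Ioi 0 ∩ g ⁻¹' N)) = 0 :=
    measure_mono_null (by rintro _ ⟨s, hs, rfl⟩; exact hs.2) hN0
  rw [setLIntegral_measure_zero _ _ himage] at key
  have hderiv : Set.EqOn (fun s => ENNReal.ofReal |g' s| * (1 : ℝ → ENNReal) (g s))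
      (fun s => ENNReal.ofReal |deriv g s|) (Set.Ioi 0 ∩ g ⁻¹' N) := fun s hs => by
    simp [(hg s hs.1).deriv]
  rw [setLIntegral_congr_fun hS hderiv, eq_comm,
    lintegral_eq_zero_iff (measurable_deriv g).abs.ennreal_ofReal] at key
  have hfalse : ∀ᵐ s ∂volume.restrict (Set.Ioi 0 ∩ g ⁻¹' N), False := by
    filter_upwards [key, ae_restrict_mem hS] with s hs hsS
    rw [(hg s hsS.1).deriv] at hs
    simp at hs
    exact absurd hs (hpos s hsS.1).ne'
  simpa [ae_iff] using hfalse

/-- If `f` has positive derivative along every open ray from the origin, then the pushforward of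
Lebesgue measure under `f` is absolutely continuous. -/
theorem map_absolutelyContinuous_of_hasDerivAt_ray {E : Type*} [NormedAddCommGroup E]
    [NormedSpace ℝ E] [FiniteDimensional ℝ E] [Nontrivial E] [MeasurableSpace E] [BorelSpace E]
    (ν : Measure E) [ν.IsAddHaarMeasure] {f : E → ℝ} (hf : Measurable f) {f' : E → ℝ → ℝ}
    (hderiv : ∀ x, x ≠ 0 → ∀ s, 0 < s → HasDerivAt (fun r : ℝ => f (r • x)) (f' x s) s)
    (hpos : ∀ x, x ≠ 0 → ∀ s, 0 < s → 0 < f' x s) :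
    ν.map f ≪ volume := by
  refine Measure.AbsolutelyContinuous.mk fun N hN hN0 => ?_
  rw [Measure.map_apply hf hN]
  have hsmul : Measurable fun p : E × ℝ => f (p.2 • p.1) :=
    hf.comp (measurable_snd.smul measurable_fst)
  have hprod : (ν.prod (volume.restrict (Set.Ioi (0 : ℝ))))
      ((fun p : E × ℝ => f (p.2 • p.1)) ⁻¹' N) = 0 := by
    rw [Measure.measure_prod_null (hsmul hN)]
    have h0 : ∀ᵐ x ∂ν, x ≠ 0 := by simp [ae_iff]
    filter_upwards [h0] with x hx
    have hx' : Measurable fun r : ℝ => f (r • x) := hf.comp (measurable_id.smul_const x)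
    have := volume_Ioi_inter_preimage_eq_zero (hderiv x hx) (hpos x hx) hx' hN hN0
    change volume.restrict (Set.Ioi 0) ((fun r : ℝ => f (r • x)) ⁻¹' N) = 0
    rw [Measure.restrict_apply (hx' hN), Set.inter_comm]
    exact this
  rw [← Measure.prod_swap, Measure.map_apply measurable_swap (hsmul hN),
    Measure.measure_prod_null (measurable_swap (hsmul hN))] at hprod
  have hne : (ae (volume.restrict (Set.Ioi (0 : ℝ)))).NeBot := by
    rw [ae_neBot]
    simp
  obtain ⟨s, hs, hs0⟩ := (hprod.and (ae_restrict_mem measurableSet_Ioi)).exists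
  have hscale := Measure.addHaar_preimage_smul ν (ne_of_gt hs0) (f ⁻¹' N)
  change ν ((fun x => s • x) ⁻¹' (f ⁻¹' N)) = 0 at hs
  rw [hs] at hscale
  have hs0' : (0 : ℝ) < s := hs0
  have : ENNReal.ofReal |(s ^ Module.finrank ℝ E)⁻¹| ≠ 0 := by
    have : 0 < (s ^ Module.finrank ℝ E)⁻¹ := by positivity
    exact (ENNReal.ofReal_pos.mpr (abs_pos.mpr this.ne')).ne'
  exact (mul_eq_zero.mp hscale.symm).resolve_left this

/-- The Riemann–Lebesgue lemma for exponentials with a real frequency. -/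
theorem tendsto_integral_mul_exp_mul_I (f : ℝ → ℂ) :
    Tendsto (fun l : ℝ => ∫ x, f x * Complex.exp (Complex.I * (x : ℂ) * (l : ℂ)))
      (Filter.cocompact ℝ) (nhds 0) := by
  have hscale : Tendsto (fun l : ℝ => l * (-(2 * Real.pi)⁻¹)) (cocompact ℝ) (cocompact ℝ) :=
    (Homeomorph.mulRight₀ _
      (neg_ne_zero.mpr (inv_ne_zero Real.two_pi_pos.ne'))).isClosedEmbedding.tendsto_cocompact
  refine ((Real.tendsto_integral_exp_smul_cocompact f).comp hscale).congr fun l => ?_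
  refine integral_congr_ae (Eventually.of_forall fun x => ?_)
  simp only [Circle.smul_def, Real.fourierChar_apply, smul_eq_mul]
  rw [mul_comm]
  congr 2
  push_cast
  have : (Real.pi : ℂ) ≠ 0 := by exact_mod_cast Real.pi_ne_zero
  field_simp

/-- Riemann–Lebesgue with a phase `φ` whose law is absolutely continuous, for real amplitudes. -/
theorem tendsto_integral_ofReal_mul_exp_phase {α : Type*} [MeasurableSpace α] {ν : Measure α}
    [SFinite ν] {φ : α → ℝ} (hφ : Measurable φ) (hac : ν.map φ ≪ volume) {h : α → ℝ}
    (hh : Integrable h ν) :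
    Tendsto (fun l : ℝ => ∫ x, (h x : ℂ) * Complex.exp (Complex.I * (φ x : ℂ) * (l : ℂ)) ∂ν)
      (Filter.cocompact ℝ) (nhds 0) := by
  have main : ∀ k : α → ℝ, Integrable k ν →
      Tendsto (fun l : ℝ => ∫ x, (((k x).toNNReal : ℝ) : ℂ) *
        Complex.exp (Complex.I * (φ x : ℂ) * (l : ℂ)) ∂ν) (Filter.cocompact ℝ) (nhds 0) := by
    intro k hk
    have hkm : AEMeasurable (fun x => ENNReal.ofReal (k x)) ν := hk.aemeasurable.ennreal_ofReal
    have : IsFiniteMeasure (ν.withDensity fun x => ENNReal.ofReal (k x)) :=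
      isFiniteMeasure_withDensity_ofReal hk.2
    set m := (ν.withDensity fun x => ENNReal.ofReal (k x)).map φ with hm
    have hmac : m ≪ volume := ((withDensity_absolutelyContinuous ν _).map hφ).trans hac
    have hmeq : volume.withDensity (m.rnDeriv volume) = m :=
      Measure.withDensity_rnDeriv_eq _ _ hmac
    refine (tendsto_integral_mul_exp_mul_I fun x => ((m.rnDeriv volume x).toReal : ℂ)).congr
      fun l => ?_
    have hcont : Continuous fun y : ℝ => Complex.exp (Complex.I * (y : ℂ) * (l : ℂ)) := by
      fun_prop
    calc ∫ y, ((m.rnDeriv volume y).toReal : ℂ) * Complex.exp (Complex.I * (y : ℂ) * (l : ℂ))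
        = ∫ y, (m.rnDeriv volume y).toReal • Complex.exp (Complex.I * (y : ℂ) * (l : ℂ)) := by
          simp only [Complex.real_smul]
      _ = ∫ y, Complex.exp (Complex.I * (y : ℂ) * (l : ℂ)) ∂m := integral_rnDeriv_smul hmac
      _ = ∫ x, Complex.exp (Complex.I * (φ x : ℂ) * (l : ℂ))
            ∂(ν.withDensity fun x => ENNReal.ofReal (k x)) :=
          integral_map hφ.aemeasurable hcont.aestronglyMeasurable
      _ = _ := by
          rw [integral_withDensity_eq_integral_toReal_smul₀ hkm
            (Eventually.of_forall fun x => ENNReal.ofReal_lt_top)]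
          simp [Complex.real_smul, ENNReal.toReal_ofReal']
  have hint : ∀ k : α → ℝ, Integrable k ν → ∀ l : ℝ, Integrable (fun x =>
      (((k x).toNNReal : ℝ) : ℂ) * Complex.exp (Complex.I * (φ x : ℂ) * (l : ℂ))) ν := by
    intro k hk l
    refine (hk.real_toNNReal.ofReal (𝕜 := ℂ)).mul_bdd (c := 1) ?_ ?_
    · exact Measurable.aestronglyMeasurable (by fun_prop)
    · refine Eventually.of_forall fun x => le_of_eq ?_
      rw [mul_assoc, mul_comm, ← Complex.ofReal_mul, Complex.norm_exp_ofReal_mul_I]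
  have := (main h hh).sub (main (-h) hh.neg)
  rw [sub_zero] at this
  refine this.congr fun l => ?_
  rw [← integral_sub (hint h hh l) (hint (-h) hh.neg l)]
  refine integral_congr_ae (Eventually.of_forall fun x => ?_)
  simp only [← sub_mul, ← Complex.ofReal_sub, Pi.neg_apply, Real.coe_toNNReal']
  rw [max_zero_sub_eq_self]

/-- Riemann–Lebesgue with a phase `φ` whose law is absolutely continuous. -/
theorem tendsto_integral_mul_exp_phase {α : Type*} [MeasurableSpace α] {ν : Measure α}
    [SFinite ν] {φ : α → ℝ} (hφ : Measurable φ) (hac : ν.map φ ≪ volume) {h : α → ℂ}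
    (hh : Integrable h ν) :
    Tendsto (fun l : ℝ => ∫ x, h x * Complex.exp (Complex.I * (φ x : ℂ) * (l : ℂ)) ∂ν)
      (Filter.cocompact ℝ) (nhds 0) := by
  have hint : ∀ k : α → ℝ, Integrable k ν → ∀ l : ℝ, Integrable (fun x =>
      (k x : ℂ) * Complex.exp (Complex.I * (φ x : ℂ) * (l : ℂ))) ν := by
    intro k hk l
    refine (hk.ofReal (𝕜 := ℂ)).mul_bdd (c := 1) ?_ ?_
    · exact Measurable.aestronglyMeasurable (by fun_prop)
    · refine Eventually.of_forall fun x => le_of_eq ?_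
      rw [mul_assoc, mul_comm, ← Complex.ofReal_mul, Complex.norm_exp_ofReal_mul_I]
  have := (tendsto_integral_ofReal_mul_exp_phase hφ hac hh.re).add
    ((tendsto_integral_ofReal_mul_exp_phase hφ hac hh.im).const_mul Complex.I)
  rw [mul_zero, add_zero] at this
  refine this.congr fun l => ?_
  rw [← integral_const_mul, ← integral_add (hint _ hh.re l) ((hint _ hh.im l).const_mul _)]
  refine integral_congr_ae (Eventually.of_forall fun x => ?_)
  simp only [← mul_assoc, ← add_mul]
  congr 1
  rw [mul_comm Complex.I]
  exact Complex.re_add_im (h x)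

/-- The water-waves dispersion relation `r ↦ √(r tanh(b r) / b)` has positive derivative along
positive rays. -/
theorem hasDerivAt_sqrt_mul_tanh {a b : ℝ} (ha : 0 < a) (hb : 0 < b) {s : ℝ} (hs : 0 < s) :
    ∃ f' : ℝ, 0 < f' ∧
      HasDerivAt (fun r : ℝ => Real.sqrt (r * a * Real.tanh (b * (r * a)) / b)) f' s := by
  have hlin : HasDerivAt (fun r : ℝ => r * a) a s := by
    simpa using (hasDerivAt_id s).mul_const a
  have hblin := hlin.const_mul b
  have hc : 0 < Real.cosh (b * (s * a)) := Real.cosh_pos _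
  have hsinh : 0 < Real.sinh (b * (s * a)) := Real.sinh_pos_iff.mpr (by positivity)
  have htanh : HasDerivAt (fun r : ℝ => Real.tanh (b * (r * a)))
      (b * a / Real.cosh (b * (s * a)) ^ 2) s := by
    simp only [Real.tanh_eq_sinh_div_cosh]
    refine (hblin.sinh.div hblin.cosh hc.ne').congr_deriv ?_
    congr 1
    linear_combination (b * a) * Real.cosh_sq (b * (s * a))
  have hval : 0 < s * a * Real.tanh (b * (s * a)) / b := by
    rw [Real.tanh_eq_sinh_div_cosh]
    positivity
  have ht : 0 < Real.tanh (b * (s * a)) := by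
    rw [Real.tanh_eq_sinh_div_cosh]
    positivity
  exact ⟨_, by positivity, ((hlin.mul htanh).div_const b).sqrt hval.ne'⟩

/-- At any fixed time `t > 0`, the Fourier transform of the free-surface
component of the solution of the linearized water-waves system in the
rigid lid scaling converges weakly to `0` in `L²` as `ε → 0⁺`. -/
theorem linear_ww_weak_convergence_to_zero
    (d : ℕ) (hd : d = 1 ∨ d = 2)
    (μ γ t : ℝ) (hμ : 0 < μ) (hγ : 0 < γ) (hγ1 : γ ≤ 1) (ht : 0 < t)
    (nγ ω : EuclideanSpace ℝ (Fin d) → ℝ)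
    (hnγ : ∀ ξ, nγ ξ =
      Real.sqrt (∑ i : Fin d, (if (i : ℕ) = 0 then (1 : ℝ) else γ) ^ 2 * ξ i ^ 2))
    (hω : ∀ ξ,
      ω ξ = Real.sqrt (nγ ξ * Real.tanh (Real.sqrt μ * nγ ξ) / Real.sqrt μ))
    (F G : EuclideanSpace ℝ (Fin d) → ℂ)
    (hFmeas : Measurable F) (hGmeas : Measurable G)
    (hF : Integrable (fun ξ => ‖F ξ‖ ^ 2))
    (hG : Integrable (fun ξ => ω ξ ^ 2 * ‖G ξ‖ ^ 2))
    (zhat : ℝ → EuclideanSpace ℝ (Fin d) → ℂ)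
    (hzhat : ∀ (ε : ℝ) ξ, zhat ε ξ =
      ((F ξ - Complex.I * (ω ξ : ℂ) * G ξ) / 2) *
          Complex.exp (Complex.I * (ω ξ : ℂ) * (t : ℂ) / (ε : ℂ))
        + ((F ξ + Complex.I * (ω ξ : ℂ) * G ξ) / 2) *
          Complex.exp (-(Complex.I * (ω ξ : ℂ) * (t : ℂ) / (ε : ℂ)))) :
    ∀ v : EuclideanSpace ℝ (Fin d) → ℂ, Measurable v →
      Integrable (fun ξ => ‖v ξ‖ ^ 2) →
      Tendsto (fun ε : ℝ => ∫ ξ, zhat ε ξ * (starRingEnd ℂ) (v ξ))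
        (nhdsWithin 0 (Set.Ioi 0)) (nhds 0) := by
  intro v hvmeas hv
  have hdim : Nonempty (Fin d) := by
    rcases hd with rfl | rfl <;> infer_instance
  have hnmeas : Measurable nγ := by
    rw [funext hnγ]
    fun_prop
  have hωmeas : Measurable ω := by
    have hω' : ω = fun ξ => Real.sqrt (nγ ξ *
        (Real.sinh (Real.sqrt μ * nγ ξ) / Real.cosh (Real.sqrt μ * nγ ξ)) / Real.sqrt μ) := by
      funext ξ
      rw [hω, Real.tanh_eq_sinh_div_cosh]
    rw [hω']
    fun_prop
  have hnpos : ∀ ξ, ξ ≠ 0 → 0 < nγ ξ := by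
    intro ξ hξ
    rw [hnγ, Real.sqrt_pos]
    obtain ⟨i, hi⟩ : ∃ i, ξ i ≠ 0 := by
      by_contra! hcon
      exact hξ (by ext i; simpa using hcon i)
    refine Finset.sum_pos' (fun j _ => by positivity) ⟨i, Finset.mem_univ i, ?_⟩
    have : 0 < (if (i : ℕ) = 0 then (1 : ℝ) else γ) := by split_ifs <;> positivity
    positivity
  have hnsmul : ∀ ξ (s : ℝ), 0 < s → nγ (s • ξ) = s * nγ ξ := by
    intro ξ s hs
    rw [hnγ, hnγ]
    conv_rhs => rw [← Real.sqrt_sq hs.le, ← Real.sqrt_mul (sq_nonneg s), Finset.mul_sum]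
    congr 1
    refine Finset.sum_congr rfl fun i _ => ?_
    simp only [PiLp.smul_apply, smul_eq_mul]
    ring
  have hray : ∀ ξ, ξ ≠ 0 → ∀ s : ℝ, 0 < s →
      0 < deriv (fun r : ℝ => ω (r • ξ)) s ∧
        HasDerivAt (fun r : ℝ => ω (r • ξ)) (deriv (fun r : ℝ => ω (r • ξ)) s) s := by
    intro ξ hξ s hs
    obtain ⟨f', hf', hder⟩ :=
      hasDerivAt_sqrt_mul_tanh (hnpos ξ hξ) (Real.sqrt_pos.mpr hμ) hs
    have hder' : HasDerivAt (fun r : ℝ => ω (r • ξ)) f' s := by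
      refine hder.congr_of_eventuallyEq ?_
      filter_upwards [Ioi_mem_nhds hs] with r hr
      rw [hω, hnsmul ξ r hr]
    rw [hder'.deriv]
    exact ⟨hf', hder'⟩
  have hac : (volume : Measure (EuclideanSpace ℝ (Fin d))).map ω ≪ volume :=
    map_absolutelyContinuous_of_hasDerivAt_ray volume hωmeas
      (fun ξ hξ s hs => (hray ξ hξ s hs).2) (fun ξ hξ s hs => (hray ξ hξ s hs).1)
  have hFL : MemLp F 2 := (memLp_two_iff_integrable_sq_norm hFmeas.aestronglyMeasurable).mpr hF
  have hGL : MemLp (fun ξ => Complex.I * (ω ξ : ℂ) * G ξ) 2 := by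
    refine (memLp_two_iff_integrable_sq_norm
      (Measurable.aestronglyMeasurable (by fun_prop))).mpr (hG.congr ?_)
    exact Eventually.of_forall fun ξ => by simp [mul_pow]
  have hvL : MemLp (fun ξ => (starRingEnd ℂ) (v ξ)) 2 := by
    refine (memLp_two_iff_integrable_sq_norm
      (Complex.continuous_conj.measurable.comp hvmeas).aestronglyMeasurable).mpr ?_
    simpa using hv
  have hA : Integrable fun ξ =>
      (F ξ - Complex.I * (ω ξ : ℂ) * G ξ) / 2 * (starRingEnd ℂ) (v ξ) := by
    refine (((hFL.sub hGL).integrable_mul hvL).div_const 2).congr (Eventually.of_forall fun ξ => ?_)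
    simp only [Pi.mul_apply, Pi.sub_apply]
    ring
  have hB : Integrable fun ξ =>
      (F ξ + Complex.I * (ω ξ : ℂ) * G ξ) / 2 * (starRingEnd ℂ) (v ξ) := by
    refine (((hFL.add hGL).integrable_mul hvL).div_const 2).congr (Eventually.of_forall fun ξ => ?_)
    simp only [Pi.mul_apply, Pi.add_apply]
    ring
  have htop : Tendsto (fun ε : ℝ => t / ε) (nhdsWithin 0 (Set.Ioi 0)) atTop := by
    simpa only [div_eq_mul_inv] using tendsto_inv_nhdsGT_zero.const_mul_atTop ht
  have hco : Tendsto (fun ε : ℝ => t / ε) (nhdsWithin 0 (Set.Ioi 0)) (cocompact ℝ) :=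
    htop.mono_right atTop_le_cocompact
  have hco' : Tendsto (fun ε : ℝ => -(t / ε)) (nhdsWithin 0 (Set.Ioi 0)) (cocompact ℝ) :=
    (tendsto_neg_atTop_atBot.comp htop).mono_right atBot_le_cocompact
  have hbdd : ∀ h : EuclideanSpace ℝ (Fin d) → ℂ, Integrable h → ∀ l : ℝ,
      Integrable fun ξ => h ξ * Complex.exp (Complex.I * (ω ξ : ℂ) * (l : ℂ)) := by
    intro h hh l
    refine hh.mul_bdd (c := 1) (Measurable.aestronglyMeasurable (by fun_prop))
      (Eventually.of_forall fun ξ => le_of_eq ?_)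
    rw [mul_assoc, mul_comm, ← Complex.ofReal_mul, Complex.norm_exp_ofReal_mul_I]
  have hlim := ((tendsto_integral_mul_exp_phase hωmeas hac hA).comp hco).add
    ((tendsto_integral_mul_exp_phase hωmeas hac hB).comp hco')
  rw [add_zero] at hlim
  refine hlim.congr fun ε => ?_
  simp only [Function.comp_apply]
  rw [← integral_add (hbdd _ hA _) (hbdd _ hB _)]
  refine integral_congr_ae (Eventually.of_forall fun ξ => ?_)
  simp only [hzhat]
  push_cast
  rw [mul_neg, mul_div_assoc (Complex.I * (ω ξ : ℂ))]
  ring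
end

section
/- For ξ ∈ ℝ² with ξ ≠ 0 and j ∈ {1, 2}, define F_j(ξ) = 2 ξ_j · sqrt(|ξ| · tanh|ξ|) / ( |ξ| · tanh|ξ| + (1 − tanh²|ξ|) · |ξ|² ). Then F_j is differentiable on { ξ : 0 < |ξ| ≤ 1 } and there exists C > 0 such that for all ξ with 0 < |ξ| ≤ 1, |∂_{ξ_j} F_j(ξ)| ≤ C / |ξ|. In particular ∂_{ξ_j} F_j is integrable over the punctured unit ball of ℝ². -/
open MeasureTheory

namespace Real

lemma hasDerivAt_tanh_one_sub_sq (x : ℝ) : HasDerivAt tanh (1 - tanh x ^ 2) x := by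
  have h := (hasDerivAt_sinh x).div (hasDerivAt_cosh x) (cosh_pos x).ne'
  have htanh : (sinh / cosh) = tanh := by
    ext y
    simp [tanh_eq_sinh_div_cosh]
  rw [htanh] at h
  refine h.congr_deriv ?_
  have := (cosh_pos x).ne'
  rw [tanh_eq_sinh_div_cosh]
  field_simp

lemma tanh_le_self_of_nonneg {x : ℝ} (hx : 0 ≤ x) : tanh x ≤ x := by
  have hd : ∀ y : ℝ, HasDerivAt (fun y => y - tanh y) (1 - (1 - tanh y ^ 2)) y := fun y =>
    (hasDerivAt_id y).sub (hasDerivAt_tanh_one_sub_sq y)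
  have hmono : Monotone fun y : ℝ => y - tanh y :=
    monotone_of_deriv_nonneg (fun y => (hd y).differentiableAt) fun y => by
      rw [(hd y).deriv]
      nlinarith [sq_nonneg (tanh y)]
  have := hmono hx
  simp only [tanh_zero, sub_zero] at this
  linarith

lemma half_le_tanh {x : ℝ} (h0 : 0 ≤ x) (h1 : x ≤ 1) : x / 2 ≤ tanh x := by
  have hsinh : x ≤ sinh x := self_le_sinh_iff.2 h0
  have hcosh : cosh x ≤ 2 := by
    have hmono : cosh x ≤ cosh 1 := cosh_le_cosh.2 (by rwa [abs_of_nonneg h0, abs_one])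
    have hexp : exp (-1) ≤ 1 := exp_le_one_iff.2 (by norm_num)
    have := exp_one_lt_three
    rw [cosh_eq 1] at hmono
    linarith
  rw [tanh_eq_sinh_div_cosh, le_div_iff₀ (cosh_pos x)]
  nlinarith

end Real

/-- The radial profile `g` such that the phase field is `F_j ξ = ξ_j * g ‖ξ‖`. -/
noncomputable def phaseProfile (r : ℝ) : ℝ :=
  2 * Real.sqrt (r * Real.tanh r) / (r * Real.tanh r + (1 - Real.tanh r ^ 2) * r ^ 2)

lemma phaseProfile_bounds {r : ℝ} (h0 : 0 < r) (h1 : r ≤ 1) :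
    |phaseProfile r| ≤ 4 / r ∧ ∃ g' : ℝ, HasDerivAt phaseProfile g' r ∧ |g'| ≤ 40 / r ^ 2 := by
  have hT := Real.hasDerivAt_tanh_one_sub_sq r
  have hT1 := Real.half_le_tanh h0.le h1
  have hT2 := Real.tanh_le_self_of_nonneg h0.le
  have hT3 := Real.tanh_sq_lt_one r
  unfold phaseProfile
  set T := Real.tanh r with hTdef
  have hq0 : 0 ≤ 1 - T ^ 2 := by linarith
  have hq1 : 1 - T ^ 2 ≤ 1 := by nlinarith [sq_nonneg T]
  have hNlow : r ^ 2 / 2 ≤ r * T := by nlinarith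
  have hN : 0 < r * T := by nlinarith [sq_pos_of_pos h0]
  have hN' : HasDerivAt (fun r => r * Real.tanh r) (1 * T + r * (1 - T ^ 2)) r :=
    (hasDerivAt_id r).mul hT
  have hs' : HasDerivAt (fun r => 2 * Real.sqrt (r * Real.tanh r))
      ((T + r * (1 - T ^ 2)) / Real.sqrt (r * T)) r := by
    refine ((hN'.sqrt hN.ne').const_mul 2).congr_deriv ?_
    rw [one_mul, ← hTdef]
    field_simp
  have hD' : HasDerivAt (fun r => r * Real.tanh r + (1 - Real.tanh r ^ 2) * r ^ 2)
      (T + r * (1 - T ^ 2) + (2 * r * (1 - T ^ 2) - 2 * T * (1 - T ^ 2) * r ^ 2)) r := by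
    refine (hN'.add (((hT.pow 2).const_sub 1).mul (hasDerivAt_pow 2 r))).congr_deriv ?_
    simp only [Pi.pow_apply, ← hTdef]
    push_cast
    ring
  set D := r * T + (1 - T ^ 2) * r ^ 2 with hDdef
  have hD : r ^ 2 / 2 ≤ D := by nlinarith [mul_nonneg hq0 (sq_nonneg r)]
  have hDpos : 0 < D := by nlinarith [sq_pos_of_pos h0]
  have hg' := hs'.div hD' hDpos.ne'
  set s := Real.sqrt (r * T) with hsdef
  have hss : s ^ 2 = r * T := Real.sq_sqrt hN.le
  have hspos : 0 < s := Real.sqrt_pos.2 hN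
  have hs_le : s ≤ r := abs_le_of_sq_le_sq' (by nlinarith) h0.le |>.2
  have hs_ge : r / 2 ≤ s := abs_le_of_sq_le_sq' (by nlinarith [sq_nonneg r]) hspos.le |>.2
  refine ⟨?_, _, hg', ?_⟩
  · rw [abs_of_nonneg (by positivity), div_le_div_iff₀ hDpos h0]
    nlinarith
  · change |((T + r * (1 - T ^ 2)) / s * D - 2 * s *
      (T + r * (1 - T ^ 2) + (2 * r * (1 - T ^ 2) - 2 * T * (1 - T ^ 2) * r ^ 2))) / D ^ 2| ≤ _
    have hT0 : 0 ≤ T := by linarith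
    have hqr : r * (1 - T ^ 2) ≤ r := by nlinarith
    have hqr0 : 0 ≤ r * (1 - T ^ 2) := by positivity
    have hTr : T * r ≤ 1 := by nlinarith
    have hTr0 : 0 ≤ T * r := by positivity
    have hA0 : 0 ≤ (T + r * (1 - T ^ 2)) / s := by positivity
    have hA : (T + r * (1 - T ^ 2)) / s ≤ 4 := by
      rw [div_le_iff₀ hspos]
      linarith
    have hd : |T + r * (1 - T ^ 2) + (2 * r * (1 - T ^ 2) - 2 * T * (1 - T ^ 2) * r ^ 2)|
        ≤ 4 * r := by
      rw [abs_le]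
      constructor <;> nlinarith [mul_nonneg hqr0 hTr0, mul_nonneg hqr0 (sub_nonneg.2 hTr)]
    have hnum : |(T + r * (1 - T ^ 2)) / s * D - 2 * s *
        (T + r * (1 - T ^ 2) + (2 * r * (1 - T ^ 2) - 2 * T * (1 - T ^ 2) * r ^ 2))|
        ≤ 4 * D + 2 * r * (4 * r) := by
      refine (abs_sub _ _).trans (add_le_add ?_ ?_)
      · rw [abs_of_nonneg (by positivity)]
        gcongr
      · rw [abs_mul, abs_of_nonneg (by positivity : 0 ≤ 2 * s)]
        gcongr
    rw [abs_div, abs_of_pos (pow_pos hDpos 2), div_le_div_iff₀ (by positivity) (by positivity)]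
    calc _ ≤ (4 * D + 2 * r * (4 * r)) * r ^ 2 := by gcongr
      _ ≤ 40 * D ^ 2 := by nlinarith [sq_nonneg r]

lemma integrableOn_inv_norm_closedBall {E : Type*} [NormedAddCommGroup E] [NormedSpace ℝ E]
    [FiniteDimensional ℝ E] [MeasurableSpace E] [BorelSpace E] {μ : Measure E}
    [μ.IsAddHaarMeasure] (hE : 2 ≤ Module.finrank ℝ E) (r : ℝ) :
    IntegrableOn (fun x : E => ‖x‖⁻¹) (Metric.closedBall 0 r) μ := by
  have h : IntegrableOn (fun x : E => ‖x‖⁻¹) (Metric.ball 0 (r + 1)) μ := by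
    refine integrableOn_ball_of_norm_le_rpow (C := 1) (α := 1) (by omega)
      (by exact_mod_cast hE) (Filter.Eventually.of_forall fun x => ?_)
      measurable_norm.inv.aestronglyMeasurable
    simp [Real.rpow_neg_one]
  exact h.mono_set (Metric.closedBall_subset_ball (by linarith))


/-- The vector field `F_j = (1/|∇ω|²) ∂_{ξ_j} ω` used in the non-stationary
phase argument for the water-waves dispersion relation in dimension `2` is
differentiable on the punctured unit ball, with `|∂_{ξ_j} F_j(ξ)| ≤ C/|ξ|`;
in particular `∂_{ξ_j} F_j` is integrable over the punctured unit ball. -/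
theorem nonstationary_phase_field_derivative_bound
    (F : Fin 2 → EuclideanSpace ℝ (Fin 2) → ℝ)
    (hF : ∀ (j : Fin 2) (ξ : EuclideanSpace ℝ (Fin 2)), ξ ≠ 0 →
      F j ξ = 2 * ξ j * Real.sqrt (‖ξ‖ * Real.tanh ‖ξ‖) /
        (‖ξ‖ * Real.tanh ‖ξ‖ + (1 - Real.tanh ‖ξ‖ ^ 2) * ‖ξ‖ ^ 2)) :
    (∃ C : ℝ, 0 < C ∧ ∀ (j : Fin 2) (ξ : EuclideanSpace ℝ (Fin 2)),
      ξ ≠ 0 → ‖ξ‖ ≤ 1 →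
        DifferentiableAt ℝ (F j) ξ ∧
        |fderiv ℝ (F j) ξ (EuclideanSpace.single j 1)| ≤ C / ‖ξ‖) ∧
    ∀ j : Fin 2,
      IntegrableOn (fun ξ => fderiv ℝ (F j) ξ (EuclideanSpace.single j 1))
        {ξ : EuclideanSpace ℝ (Fin 2) | ξ ≠ 0 ∧ ‖ξ‖ ≤ 1} := by
  have hd : Module.finrank ℝ (EuclideanSpace ℝ (Fin 2)) = 2 := by simp
  have key : ∀ (j : Fin 2) (ξ : EuclideanSpace ℝ (Fin 2)), ξ ≠ 0 → ‖ξ‖ ≤ 1 →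
      DifferentiableAt ℝ (F j) ξ ∧
      |fderiv ℝ (F j) ξ (EuclideanSpace.single j 1)| ≤ 44 / ‖ξ‖ := by
    intro j ξ hξ h1
    have h0 : 0 < ‖ξ‖ := norm_pos_iff.2 hξ
    obtain ⟨hg, g', hg', hgb⟩ := phaseProfile_bounds h0 h1
    have hnorm : HasFDerivAt (fun x : EuclideanSpace ℝ (Fin 2) => ‖x‖)
        (fderiv ℝ (fun x => ‖x‖) ξ) ξ :=
      (differentiableAt_id.norm ℝ hξ).hasFDerivAt
    have hN : |fderiv ℝ (fun x : EuclideanSpace ℝ (Fin 2) => ‖x‖) ξ (EuclideanSpace.single j 1)| ≤ 1 := by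
      have := (fderiv ℝ (fun x : EuclideanSpace ℝ (Fin 2) => ‖x‖) ξ).le_of_opNorm_le
        (norm_fderiv_le_of_lipschitz ℝ lipschitzWith_one_norm) (EuclideanSpace.single j 1)
      simpa using this
    have hcoord : HasFDerivAt (fun x : EuclideanSpace ℝ (Fin 2) => x j)
        (EuclideanSpace.proj j : EuclideanSpace ℝ (Fin 2) →L[ℝ] ℝ) ξ :=
      (EuclideanSpace.proj j : EuclideanSpace ℝ (Fin 2) →L[ℝ] ℝ).hasFDerivAt
    have hprod := hcoord.mul (hg'.comp_hasFDerivAt ξ hnorm)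
    have hFξ := hprod.congr_of_eventuallyEq (f₁ := F j) <| by
      filter_upwards [isOpen_ne.mem_nhds hξ] with x hx
      rw [hF j x hx]
      simp only [Pi.mul_apply, Function.comp_apply, phaseProfile]
      ring
    refine ⟨hFξ.differentiableAt, ?_⟩
    rw [hFξ.fderiv]
    have hξj : |ξ j| ≤ ‖ξ‖ := PiLp.norm_apply_le ξ j
    set n := fderiv ℝ (fun x : EuclideanSpace ℝ (Fin 2) => ‖x‖) ξ (EuclideanSpace.single j 1)
    have hval : |ξ j * (g' * n) + phaseProfile ‖ξ‖| ≤ 44 / ‖ξ‖ := by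
      calc |ξ j * (g' * n) + phaseProfile ‖ξ‖|
          ≤ |ξ j| * (|g'| * |n|) + |phaseProfile ‖ξ‖| := by
            rw [← abs_mul, ← abs_mul]
            exact abs_add_le _ _
        _ ≤ ‖ξ‖ * (40 / ‖ξ‖ ^ 2 * 1) + 4 / ‖ξ‖ := by gcongr
        _ = 44 / ‖ξ‖ := by
            field_simp
            norm_num
    simpa using hval
  refine ⟨⟨44, by norm_num, key⟩, fun j => ?_⟩
  have hsub : {ξ : EuclideanSpace ℝ (Fin 2) | ξ ≠ 0 ∧ ‖ξ‖ ≤ 1} ⊆ Metric.closedBall 0 1 :=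
    fun ξ hξ => mem_closedBall_zero_iff.2 hξ.2
  have hmeas : MeasurableSet {ξ : EuclideanSpace ℝ (Fin 2) | ξ ≠ 0 ∧ ‖ξ‖ ≤ 1} :=
    (measurableSet_singleton 0).compl.inter (measurableSet_le measurable_norm measurable_const)
  refine (((integrableOn_inv_norm_closedBall hd.ge 1).mono_set hsub).const_mul 44).mono'
    (measurable_fderiv_apply_const ℝ (F j) _).aestronglyMeasurable ?_
  filter_upwards [ae_restrict_mem hmeas] with ξ hξ
  rw [Real.norm_eq_abs, ← div_eq_mul_inv]
  exact (key j ξ hξ.1 hξ.2).2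
end

section
/- Let μ > 0 and define ω(ξ) = sqrt(|ξ| · tanh(√μ · |ξ|) / √μ) for ξ ∈ ℝ. For a Schwartz function φ : ℝ → ℂ and t > 0, define (e^{i t ω(D)} φ)(x) = (1/(2π)) ∫_ℝ exp(i x ξ + i t ω(ξ)) · φ̂(ξ) dξ, where φ̂(ξ) = ∫_ℝ exp(−i x ξ) φ(x) dx. Then there exists C > 0 independent of μ such that for all μ > 0, all t > 0 and all Schwartz functions φ: sup_{x ∈ ℝ} |(e^{i t ω(D)} φ)(x)| ≤ C · ( μ^{−1/4} · (t/√μ)^{−1/8} + (t/√μ)^{−1/2} ) · ( ‖φ‖_{H¹} + ‖x · φ'(x)‖_{L²} ), where ‖φ‖_{H¹} = ( ‖φ‖_{L²}² + ‖φ'‖_{L²}² )^{1/2}. -/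
open MeasureTheory

/-- The **van der Corput lemma** for a phase `ψ` with `ψ'' ≤ -l < 0`. -/
theorem norm_integral_exp_mul_I_le_of_deriv2_le {ψ p p' : ℝ → ℝ} {a b l : ℝ} (hab : a ≤ b)
    (hl : 0 < l) (hψ : ∀ x ∈ Set.Icc a b, HasDerivAt ψ (p x) x)
    (hp : ∀ x ∈ Set.Icc a b, HasDerivAt p (p' x) x) (hp' : ContinuousOn p' (Set.Icc a b))
    (hle : ∀ x ∈ Set.Icc a b, p' x ≤ -l) :
    ‖∫ x in a..b, Complex.exp (Complex.I * (ψ x : ℂ))‖ ≤ 8 / √l := by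
  have hD : ∀ x, 0 < p x ^ 2 + l := fun x ↦ by positivity
  have hs : 0 < √l := Real.sqrt_pos.2 hl
  have hss : √l ^ 2 = l := Real.sq_sqrt hl.le
  have hψc : ContinuousOn ψ (Set.Icc a b) := fun x hx ↦ (hψ x hx).continuousAt.continuousWithinAt
  have hpc : ContinuousOn p (Set.Icc a b) := fun x hx ↦ (hp x hx).continuousAt.continuousWithinAt
  -- `r = p / (p² + l)` replaces the singular amplitude `1 / p`
  set r : ℝ → ℝ := fun x ↦ p x / (p x ^ 2 + l) with hr
  set r' : ℝ → ℝ := fun x ↦ p' x * (l - p x ^ 2) / (p x ^ 2 + l) ^ 2 with hr'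
  set e : ℝ → ℂ := fun x ↦ Complex.exp (Complex.I * (ψ x : ℂ)) with he
  set A : ℝ → ℝ := fun x ↦ -(Real.arctan (p x / √l) / √l) with hA
  have hrd : ∀ x ∈ Set.Icc a b, HasDerivAt r (r' x) x := fun x hx ↦ by
    refine ((hp x hx).div (((hp x hx).pow 2).add_const l) (hD x).ne').congr_deriv ?_
    simp only [hr', Pi.pow_apply, Nat.cast_ofNat]
    congr 1
    ring
  have hed : ∀ x ∈ Set.Icc a b, HasDerivAt e (e x * (Complex.I * p x)) x := fun x hx ↦
    ((hψ x hx).ofReal_comp.const_mul Complex.I).cexp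
  have hAd : ∀ x ∈ Set.Icc a b, HasDerivAt A (-p' x / (p x ^ 2 + l)) x := fun x hx ↦ by
    refine ((((hp x hx).div_const √l).arctan).div_const √l).neg.congr_deriv ?_
    rw [div_pow, hss]
    have := hD x
    have h2 : 1 + p x ^ 2 / l ≠ 0 := by positivity
    field_simp
    rw [hss]; field_simp; ring
  have hec : ContinuousOn e (Set.Icc a b) := fun x hx ↦
    (hed x hx).continuousAt.continuousWithinAt
  have hne : ∀ x, ‖e x‖ = 1 := fun x ↦ by
    simp only [he]; rw [mul_comm]; exact Complex.norm_exp_ofReal_mul_I _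
  have hr'c : ContinuousOn r' (Set.Icc a b) :=
    (hp'.mul (continuousOn_const.sub (hpc.pow 2))).div (((hpc.pow 2).add continuousOn_const).pow 2)
      fun x _ ↦ (pow_pos (hD x) 2).ne'
  have hA'c : ContinuousOn (fun x ↦ -p' x / (p x ^ 2 + l)) (Set.Icc a b) :=
    hp'.neg.div ((hpc.pow 2).add continuousOn_const) fun x _ ↦ (hD x).ne'
  set G : ℝ → ℂ := fun x ↦ e x * (r' x + Complex.I * (p x * r x : ℝ)) with hG
  have hGc : ContinuousOn G (Set.Icc a b) := by
    refine hec.mul ((Complex.continuous_ofReal.comp_continuousOn hr'c).add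
      (continuousOn_const.mul (Complex.continuous_ofReal.comp_continuousOn (hpc.mul ?_))))
    exact fun x hx ↦ (hrd x hx).continuousAt.continuousWithinAt
  rw [← Set.uIcc_of_le hab] at hrd hed hAd hA'c hGc hec
  have h1 : ∫ x in a..b, G x = e b * r b - e a * r a := by
    refine intervalIntegral.integral_eq_sub_of_hasDerivAt (f := fun x ↦ e x * r x) (fun x hx ↦ ?_)
      hGc.intervalIntegrable
    refine ((hed x hx).mul (hrd x hx).ofReal_comp).congr_deriv ?_
    simp only [hG]; push_cast; ring
  have h2 : ∫ x in a..b, -p' x / (p x ^ 2 + l) = A b - A a :=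
    intervalIntegral.integral_eq_sub_of_hasDerivAt hAd hA'c.intervalIntegrable
  have hrb : ∀ x, |r x| ≤ 1 / √l / 2 := fun x ↦ by
    simp only [hr]
    rw [abs_div, abs_of_pos (hD x), div_le_iff₀ (hD x)]
    have : 1 / √l / 2 * (p x ^ 2 + l) = (|p x| ^ 2 + √l ^ 2) / (2 * √l) := by
      rw [sq_abs, hss]; field_simp
    rw [this, le_div_iff₀ (by positivity)]
    nlinarith [sq_nonneg (|p x| - √l)]
  have h3 : ‖∫ x in a..b, (e x - -Complex.I * G x)‖ ≤ ∫ x in a..b, 2 * (-p' x / (p x ^ 2 + l)) := by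
    refine intervalIntegral.norm_integral_le_of_norm_le hab ?_
      (hA'c.intervalIntegrable.const_mul 2)
    refine Filter.Eventually.of_forall fun x hx ↦ ?_
    have hx' : x ∈ Set.Icc a b := Set.Ioc_subset_Icc_self hx
    have h0 := hle x hx'
    have : e x - -Complex.I * G x
        = e x * ((l / (p x ^ 2 + l) : ℝ) + Complex.I * (r' x : ℝ)) := by
      have h4 : (l / (p x ^ 2 + l) : ℝ) = 1 - p x * r x := by
        simp only [hr]; field_simp [(hD x).ne']; ring
      rw [h4]; simp only [hG]; push_cast
      linear_combination ((e x) * (p x) * (r x)) * Complex.I_sq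
    rw [this, norm_mul, hne, one_mul]
    refine (norm_add_le _ _).trans ?_
    rw [norm_mul, Complex.norm_I, one_mul, Complex.norm_real, Complex.norm_real, two_mul]
    gcongr
    · rw [Real.norm_of_nonneg (div_nonneg hl.le (hD x).le)]
      have := (hD x).le
      gcongr; linarith
    · rw [Real.norm_eq_abs, abs_div, abs_mul, abs_of_nonpos (by linarith : p' x ≤ 0),
        abs_of_pos (pow_pos (hD x) 2), div_le_div_iff₀ (pow_pos (hD x) 2) (hD x)]
      have : |l - p x ^ 2| ≤ p x ^ 2 + l := by
        rw [abs_le]; constructor <;> nlinarith [sq_nonneg (p x)]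
      have h5 : 0 ≤ -p' x := by linarith
      calc -p' x * |l - p x ^ 2| * (p x ^ 2 + l) ≤ -p' x * (p x ^ 2 + l) * (p x ^ 2 + l) := by
            have := (hD x).le
            gcongr
        _ = _ := by ring
  rw [intervalIntegral.integral_const_mul, h2,
    intervalIntegral.integral_sub hec.intervalIntegrable (hGc.intervalIntegrable.const_mul _),
    intervalIntegral.integral_const_mul, h1] at h3
  have h4 : A b - A a ≤ Real.pi / √l := by
    simp only [hA]
    have h5 := (Real.arctan_lt_pi_div_two (p a / √l)).le
    have h6 := (Real.neg_pi_div_two_lt_arctan (p b / √l)).le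
    rw [neg_sub_neg, ← sub_div]; gcongr; linarith
  have h5 : ‖-Complex.I * (e b * r b - e a * r a)‖ ≤ 1 / √l := by
    rw [norm_mul, norm_neg, Complex.norm_I, one_mul]
    refine (norm_sub_le _ _).trans ?_
    rw [norm_mul, norm_mul, hne, hne, Complex.norm_real, Complex.norm_real, Real.norm_eq_abs,
      Real.norm_eq_abs]
    linarith [hrb a, hrb b]
  have h6 := norm_le_norm_add_norm_sub' (∫ x in a..b, e x) (-Complex.I * (e b * r b - e a * r a))
  have h7 : 1 / √l + 2 * (Real.pi / √l) ≤ 8 / √l := by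
    rw [← mul_div_assoc, ← add_div]; gcongr; linarith [Real.pi_lt_d2]
  linarith

/-- Integration by parts turns bounds on the primitive of `θ` into a bound for `θ x / x`. -/
theorem norm_integral_div_le {θ : ℝ → ℂ} (hθ : Continuous θ) {L : ℝ → ℝ} {a b : ℝ} (ha : 0 < a)
    (hab : a ≤ b) (hL : ContinuousOn L (Set.Icc a b))
    (h : ∀ c ∈ Set.Icc a b, ‖∫ x in a..c, θ x‖ ≤ L c) :
    ‖∫ x in a..b, θ x / x‖ ≤ L b / b + ∫ x in a..b, L x / x ^ 2 := by
  have hpos : ∀ x ∈ Set.uIcc a b, 0 < x := fun x hx ↦ by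
    rw [Set.uIcc_of_le hab] at hx; exact ha.trans_le hx.1
  set E : ℝ → ℂ := fun c ↦ ∫ x in a..c, θ x with hE
  have hEd : ∀ x, HasDerivAt E (θ x) x := fun x ↦ hθ.integral_hasStrictDerivAt a x |>.hasDerivAt
  have hi : ∀ x ∈ Set.uIcc a b, HasDerivAt (fun x : ℝ ↦ ((x⁻¹ : ℝ) : ℂ)) ((-(x ^ 2)⁻¹ : ℝ) : ℂ) x :=
    fun x hx ↦ (hasDerivAt_inv (hpos x hx).ne').ofReal_comp
  have hic : ContinuousOn (fun x : ℝ ↦ -(x ^ 2)⁻¹) (Set.uIcc a b) :=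
    ((continuousOn_pow 2).inv₀ fun x hx ↦ (pow_pos (hpos x hx) 2).ne').neg
  have key := intervalIntegral.integral_mul_deriv_eq_deriv_mul (a := a) (b := b) hi
    (fun x _ ↦ hEd x) (Complex.continuous_ofReal.comp_continuousOn hic).intervalIntegrable
    (hθ.intervalIntegrable a b)
  have h0 : ∫ x in a..b, θ x / x = ∫ x in a..b, ((x⁻¹ : ℝ) : ℂ) * θ x := by
    congr 1; ext x; push_cast; rw [div_eq_mul_inv, mul_comm]
  have hEa : E a = 0 := by simp [hE]
  rw [h0, key, hEa, mul_zero, sub_zero]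
  refine (norm_sub_le _ _).trans (add_le_add ?_ ?_)
  · have hb : 0 < b := ha.trans_le hab
    rw [norm_mul, Complex.norm_real, Real.norm_of_nonneg (inv_nonneg.2 hb.le), mul_comm,
      ← div_eq_mul_inv]
    gcongr
    exact h b ⟨hab, le_rfl⟩
  · refine intervalIntegral.norm_integral_le_of_norm_le hab ?_ ?_
    · refine Filter.Eventually.of_forall fun x hx ↦ ?_
      rw [norm_mul, Complex.norm_real, norm_neg, Real.norm_of_nonneg (by positivity), mul_comm,
        ← div_eq_mul_inv]
      gcongr
      exact h x (Set.Ioc_subset_Icc_self hx)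
    · rw [← Set.uIcc_of_le hab] at hL
      exact (hL.div (continuousOn_pow 2) fun x hx ↦
        (pow_pos (hpos x hx) 2).ne').intervalIntegrable

section Dispersion

open Real

/-- The dispersion relation `√(η tanh η)` in the normalised case `μ = 1`. -/
noncomputable def dispersion (η : ℝ) : ℝ := √(η * tanh η)

/-- The derivative of `dispersion` on `(0, ∞)`. -/
noncomputable def dispersionDeriv (η : ℝ) : ℝ :=
  (tanh η + η * (1 - tanh η ^ 2)) / (2 * √(η * tanh η))

/-- The second derivative of `dispersion` on `(0, ∞)`. -/
noncomputable def dispersionDeriv2 (η : ℝ) : ℝ :=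
  -((tanh η - η * (1 - tanh η ^ 2)) ^ 2 + 4 * η ^ 2 * tanh η ^ 2 * (1 - tanh η ^ 2)) /
    (4 * (η * tanh η) * √(η * tanh η))

theorem one_sub_tanh_sq (x : ℝ) : 1 - tanh x ^ 2 = 1 / cosh x ^ 2 := by
  have := (cosh_pos x).ne'
  rw [tanh_eq_sinh_div_cosh, div_pow]
  field_simp
  linarith [cosh_sq x]

theorem hasDerivAt_tanh (x : ℝ) : HasDerivAt tanh (1 - tanh x ^ 2) x := by
  have h : tanh = fun x ↦ sinh x / cosh x := funext tanh_eq_sinh_div_cosh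
  have hc := (cosh_pos x).ne'
  rw [one_sub_tanh_sq, h]
  refine ((hasDerivAt_sinh x).div (hasDerivAt_cosh x) hc).congr_deriv ?_
  congr 1
  linarith [cosh_sq x]

theorem continuous_tanh : Continuous tanh :=
  continuous_iff_continuousAt.2 fun x ↦ (hasDerivAt_tanh x).continuousAt

theorem tanh_pos_of_pos {x : ℝ} (hx : 0 < x) : 0 < tanh x := by
  rw [tanh_eq_sinh_div_cosh]; exact div_pos (sinh_pos_iff.2 hx) (cosh_pos x)

theorem tanh_le_self {x : ℝ} (hx : 0 ≤ x) : tanh x ≤ x := by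
  have h : MonotoneOn (fun y ↦ y - tanh y) (Set.Ici 0) := by
    refine monotoneOn_of_deriv_nonneg (convex_Ici 0) (continuous_id.sub continuous_tanh).continuousOn
      (fun y _ ↦ ((hasDerivAt_id y).sub (hasDerivAt_tanh y)).differentiableAt.differentiableWithinAt)
      fun y _ ↦ ?_
    have h1 : deriv (fun y ↦ y - tanh y) y = 1 - (1 - tanh y ^ 2) :=
      ((hasDerivAt_id' y).sub (hasDerivAt_tanh y)).deriv
    rw [h1]
    nlinarith [sq_nonneg (tanh y)]
  have := h Set.self_mem_Ici hx hx
  simp only [tanh_zero, sub_zero] at this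
  linarith

theorem continuous_dispersion : Continuous dispersion :=
  (continuous_id.mul continuous_tanh).sqrt

theorem hasDerivAt_mul_tanh (x : ℝ) :
    HasDerivAt (fun η ↦ η * tanh η) (tanh x + x * (1 - tanh x ^ 2)) x :=
  ((hasDerivAt_id' x).mul (hasDerivAt_tanh x)).congr_deriv (by ring)

theorem hasDerivAt_dispersion {x : ℝ} (hx : 0 < x) :
    HasDerivAt dispersion (dispersionDeriv x) x :=
  (hasDerivAt_mul_tanh x).sqrt (mul_pos hx (tanh_pos_of_pos hx)).ne'

theorem hasDerivAt_dispersionDeriv {x : ℝ} (hx : 0 < x) :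
    HasDerivAt dispersionDeriv (dispersionDeriv2 x) x := by
  have hT := tanh_pos_of_pos hx
  have hq : 0 < x * tanh x := mul_pos hx hT
  have hs : 0 < √(x * tanh x) := sqrt_pos.2 hq
  have h1 : HasDerivAt (fun η ↦ tanh η + η * (1 - tanh η ^ 2))
      (2 * (1 - tanh x ^ 2) * (1 - x * tanh x)) x := by
    refine ((hasDerivAt_tanh x).add ((hasDerivAt_id' x).mul
      (((hasDerivAt_tanh x).pow 2).const_sub 1))).congr_deriv ?_
    simp only [Pi.pow_apply, Nat.cast_ofNat]
    ring
  refine (h1.div (((hasDerivAt_mul_tanh x).sqrt hq.ne').const_mul 2) (by positivity)).congr_deriv ?_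
  have hss : √(x * tanh x) ^ 2 = x * tanh x := sq_sqrt hq.le
  rw [dispersionDeriv2, ← hss]
  rw [sqrt_sq hs.le]
  set s := √(x * tanh x)
  field_simp
  rw [hss]
  ring

theorem continuousOn_dispersionDeriv2 : ContinuousOn dispersionDeriv2 (Set.Ioi 0) := by
  have hT := continuous_tanh
  unfold dispersionDeriv2
  refine ContinuousOn.div (by fun_prop) (by fun_prop) fun x hx ↦ ?_
  have hq : 0 < x * tanh x := mul_pos hx (tanh_pos_of_pos hx)
  have hs : 0 < √(x * tanh x) := sqrt_pos.2 hq
  positivity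

theorem cosh_one_le_two : cosh 1 ≤ 2 := by
  rw [cosh_eq]
  have h1 := exp_one_lt_d9
  have h2 : exp (-1) ≤ 1 := exp_le_one_iff.2 (by norm_num)
  linarith

theorem three_halves_le_cosh_one : 3 / 2 ≤ cosh 1 := by
  rw [cosh_eq, exp_neg]
  have h1 := exp_one_lt_d9
  have h2 := exp_one_gt_d9
  have h3 : 1 / 3 ≤ (exp 1)⁻¹ := by
    rw [one_div]; gcongr; linarith
  linarith

theorem dispersionDeriv2_le_of_le_one {x : ℝ} (hx : 0 < x) (hx1 : x ≤ 1) :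
    dispersionDeriv2 x ≤ -(x / 16) := by
  have hT := tanh_pos_of_pos hx
  have hTx := tanh_le_self hx.le
  have hc : cosh x ≤ 2 := (cosh_le_cosh.2 (by rwa [abs_of_pos hx, abs_one])).trans cosh_one_le_two
  have hc0 := cosh_pos x
  have hS : 1 / 4 ≤ 1 - tanh x ^ 2 := by
    rw [one_sub_tanh_sq, div_le_div_iff₀ (by norm_num) (by positivity)]
    nlinarith
  have hTl : x / 2 ≤ tanh x := by
    rw [tanh_eq_sinh_div_cosh, div_le_div_iff₀ (by norm_num) hc0]
    have := self_le_sinh_iff.2 hx.le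
    nlinarith
  have hq : 0 < x * tanh x := mul_pos hx hT
  have hs : 0 < √(x * tanh x) := sqrt_pos.2 hq
  have hqx : x * tanh x ≤ x ^ 2 := by nlinarith
  have hsx : √(x * tanh x) ≤ x := sqrt_le_iff.2 ⟨hx.le, hqx⟩
  rw [dispersionDeriv2, neg_div, neg_le_neg_iff, le_div_iff₀ (by positivity)]
  calc x / 16 * (4 * (x * tanh x) * √(x * tanh x)) ≤ x / 16 * (4 * x ^ 2 * x) := by gcongr
    _ = 4 * x ^ 2 * (x / 2) ^ 2 * (1 / 4) := by ring
    _ ≤ 4 * x ^ 2 * tanh x ^ 2 * (1 - tanh x ^ 2) := by gcongr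
    _ ≤ _ := le_add_of_nonneg_left (sq_nonneg _)

theorem dispersionDeriv2_le_of_one_le {x : ℝ} (hx : 1 ≤ x) :
    dispersionDeriv2 x ≤ -(1 / (100 * (x * √x))) := by
  have hx0 : 0 < x := by linarith
  have hT := tanh_pos_of_pos hx0
  have hT1 := (tanh_lt_one x).le
  have hc0 := cosh_pos x
  have hc : 3 / 2 ≤ cosh x := by
    refine three_halves_le_cosh_one.trans (cosh_le_cosh.2 ?_)
    rwa [abs_one, abs_of_pos hx0]
  have hS : 1 - tanh x ^ 2 ≤ 4 / 9 := by
    rw [one_sub_tanh_sq, div_le_div_iff₀ (by positivity) (by norm_num)]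
    nlinarith
  have hd : tanh x / 3 ≤ tanh x - x * (1 - tanh x ^ 2) := by
    have h1 := self_le_sinh_iff.2 hx0.le
    have h2 : x * (1 - tanh x ^ 2) ≤ tanh x * (2 / 3) := by
      rw [one_sub_tanh_sq, tanh_eq_sinh_div_cosh, div_mul_div_comm, mul_one_div,
        div_le_div_iff₀ (by positivity) (by positivity)]
      have : 0 < sinh x := hx0.trans_le h1
      calc x * (cosh x * 3) ≤ sinh x * (cosh x * (2 * cosh x)) := by gcongr; linarith
        _ = _ := by ring
    linarith
  have hq : 0 < x * tanh x := mul_pos hx0 hT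
  have hs : 0 < √(x * tanh x) := sqrt_pos.2 hq
  have hqx : x * tanh x ≤ x := by nlinarith
  have hsx : √(x * tanh x) ≤ √x := sqrt_le_sqrt hqx
  have hsx0 : 0 < √x := sqrt_pos.2 hx0
  rw [dispersionDeriv2, neg_div, neg_le_neg_iff, le_div_iff₀ (by positivity), one_div_mul_eq_div,
    div_le_iff₀ (by positivity)]
  calc 4 * (x * tanh x) * √(x * tanh x) ≤ 4 * x * √x := by gcongr
    _ = (1 / 25) * (100 * (x * √x)) := by ring
    _ ≤ _ := by
      gcongr
      have h3 : (tanh x / 3) ^ 2 ≤ (tanh x - x * (1 - tanh x ^ 2)) ^ 2 := by gcongr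
      have h4 : 0 ≤ 4 * x ^ 2 * tanh x ^ 2 * (1 - tanh x ^ 2) := by
        have : 0 ≤ 1 - tanh x ^ 2 := by nlinarith
        positivity
      nlinarith

/-- The oscillatory factor in the normalised case `μ = 1`. -/
noncomputable def osc (x τ η : ℝ) : ℂ := Complex.exp (Complex.I * (x * η + τ * dispersion η : ℝ))

theorem continuous_osc (x τ : ℝ) : Continuous (osc x τ) := by
  have := continuous_dispersion
  unfold osc
  fun_prop

theorem norm_osc (x τ η : ℝ) : ‖osc x τ η‖ = 1 := by
  rw [osc, mul_comm]; exact Complex.norm_exp_ofReal_mul_I _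

theorem norm_integral_osc_le (x : ℝ) {τ a b l : ℝ} (hτ : 0 < τ) (ha : 0 < a) (hab : a ≤ b)
    (hl : 0 < l) (h : ∀ η ∈ Set.Icc a b, dispersionDeriv2 η ≤ -l) :
    ‖∫ η in a..b, osc x τ η‖ ≤ 8 / √(τ * l) := by
  have hpos : ∀ η ∈ Set.Icc a b, 0 < η := fun η hη ↦ ha.trans_le hη.1
  refine norm_integral_exp_mul_I_le_of_deriv2_le (p := fun η ↦ x + τ * dispersionDeriv η)
    (p' := fun η ↦ τ * dispersionDeriv2 η) hab (mul_pos hτ hl) (fun η hη ↦ ?_) (fun η hη ↦ ?_) ?_ ?_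
  · exact (((hasDerivAt_id' η).const_mul x).add
      ((hasDerivAt_dispersion (hpos η hη)).const_mul τ)).congr_deriv (by ring)
  · exact ((hasDerivAt_dispersionDeriv (hpos η hη)).const_mul τ).const_add x
  · exact (continuousOn_dispersionDeriv2.mono hpos).const_mul τ
  · intro η hη
    have := mul_le_mul_of_nonneg_left (h η hη) hτ.le
    linarith

theorem norm_integral_osc_div_le_low (x : ℝ) {τ a b : ℝ} (hτ : 0 < τ) (ha : 0 < a) (hab : a ≤ b)
    (hb : b ≤ 1) : ‖∫ η in a..b, osc x τ η / η‖ ≤ 32 / (√τ * √a * a) := by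
  have hb0 := ha.trans_le hab
  have hsτ := sqrt_pos.2 hτ
  have hsa := sqrt_pos.2 ha
  have key := norm_integral_div_le (continuous_osc x τ) (L := fun _ ↦ 32 / (√τ * √a)) ha hab
    continuousOn_const fun c hc ↦ by
      refine (norm_integral_osc_le x (l := a / 16) hτ ha hc.1 (by positivity) fun η hη ↦ ?_).trans ?_
      · refine (dispersionDeriv2_le_of_le_one (ha.trans_le hη.1)
          (hη.2.trans (hc.2.trans hb))).trans ?_
        linarith [hη.1]
      · rw [sqrt_mul hτ.le, sqrt_div ha.le, show √(16 : ℝ) = 4 by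
          rw [show (16 : ℝ) = 4 ^ 2 by norm_num, sqrt_sq (by norm_num)]]
        apply le_of_eq; field_simp; norm_num
  refine key.trans (le_of_eq ?_)
  have : ∫ η in a..b, 32 / (√τ * √a) / η ^ 2 = 32 / (√τ * √a) * (1 / a - 1 / b) := by
    rw [intervalIntegral.integral_eq_sub_of_hasDerivAt
      (f := fun η ↦ -(32 / (√τ * √a) * η⁻¹)) (fun η hη ↦ ?_) ?_]
    · ring
    · refine ContinuousOn.intervalIntegrable (continuousOn_const.div (continuousOn_pow 2) ?_)
      intro η hη
      rw [Set.uIcc_of_le hab] at hη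
      exact (pow_pos (ha.trans_le hη.1) 2).ne'
    · rw [Set.uIcc_of_le hab] at hη
      refine ((hasDerivAt_inv (ha.trans_le hη.1).ne').const_mul _).neg.congr_deriv ?_
      ring
  rw [this]; field_simp; ring

theorem norm_integral_osc_div_le_high (x : ℝ) {τ b : ℝ} (hτ : 0 < τ) (hb : 1 ≤ b) :
    ‖∫ η in (1)..b, osc x τ η / η‖ ≤ 320 / √τ := by
  have hsτ := sqrt_pos.2 hτ
  have hb0 : 0 < b := by linarith
  have key := norm_integral_div_le (continuous_osc x τ) (L := fun c ↦ 80 / √τ * c ^ (3 / 4 : ℝ))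
    one_pos hb (continuousOn_const.mul (continuousOn_id.rpow_const fun _ _ ↦ Or.inr (by norm_num)))
    fun c hc ↦ by
      have hc0 : 0 < c := by linarith [hc.1]
      have hsc := sqrt_pos.2 hc0
      refine (norm_integral_osc_le x (l := 1 / (100 * (c * √c))) hτ one_pos hc.1 (by positivity)
        fun η hη ↦ ?_).trans ?_
      · refine (dispersionDeriv2_le_of_one_le hη.1).trans ?_
        have : 0 < η := by linarith [hη.1]
        have := sqrt_pos.2 this
        gcongr
        · exact hη.2
        · exact hη.2
      · have h1 : 100 * (c * √c) = (10 * c ^ (3 / 4 : ℝ)) ^ 2 := by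
          rw [mul_pow, ← rpow_natCast (c ^ _), ← rpow_mul hc0.le, sqrt_eq_rpow]
          nth_rw 1 [← rpow_one c]
          rw [← rpow_add hc0]; norm_num
        rw [sqrt_mul hτ.le, h1, sqrt_div zero_le_one, sqrt_one, sqrt_sq (by positivity)]
        apply le_of_eq; field_simp; norm_num
  refine key.trans ?_
  have h0 : ∀ η : ℝ, 0 < η → η ^ (3 / 4 : ℝ) / η ^ 2 = η ^ (-(5 / 4) : ℝ) := fun η hη ↦ by
    rw [← rpow_natCast, ← rpow_sub hη]; norm_num
  have h1 : ∫ η in (1)..b, 80 / √τ * η ^ (3 / 4 : ℝ) / η ^ 2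
      = 80 / √τ * (4 - 4 * b ^ (-(1 / 4) : ℝ)) := by
    rw [intervalIntegral.integral_congr (g := fun η ↦ 80 / √τ * η ^ (-(5 / 4) : ℝ))
      fun η hη ↦ ?_, intervalIntegral.integral_const_mul, integral_rpow]
    · norm_num; left; ring
    · right; refine ⟨by norm_num, fun h ↦ ?_⟩
      rw [Set.uIcc_of_le hb] at h; linarith [h.1]
    · rw [Set.uIcc_of_le hb] at hη
      simp only
      rw [mul_div_assoc, h0 η (by linarith [hη.1])]
  have h2 : b ^ (3 / 4 : ℝ) / b = b ^ (-(1 / 4) : ℝ) := by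
    nth_rw 2 [← rpow_one b]
    rw [← rpow_sub hb0]; norm_num
  rw [h1, mul_div_assoc, h2, ← mul_add, show 320 / √τ = 80 / √τ * 4 by ring]
  gcongr
  linarith [rpow_nonneg hb0.le (-(1 / 4) : ℝ)]

end Dispersion

/-- The Cauchy–Schwarz inequality for nonnegative square integrable functions. -/
theorem integral_mul_le_sqrt_mul_sqrt {α : Type*} [MeasurableSpace α] {ν : Measure α}
    {u v : α → ℝ} (hu0 : ∀ x, 0 ≤ u x) (hv0 : ∀ x, 0 ≤ v x) (hu : AEStronglyMeasurable u ν)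
    (hv : AEStronglyMeasurable v ν) (hu2 : Integrable (fun x ↦ u x ^ 2) ν)
    (hv2 : Integrable (fun x ↦ v x ^ 2) ν) :
    ∫ x, u x * v x ∂ν ≤ √(∫ x, u x ^ 2 ∂ν) * √(∫ x, v x ^ 2 ∂ν) := by
  have h := integral_mul_le_Lp_mul_Lq_of_nonneg Real.HolderConjugate.two_two
    (Filter.Eventually.of_forall hu0) (Filter.Eventually.of_forall hv0)
    (by simpa using (memLp_two_iff_integrable_sq hu).2 hu2)
    (by simpa using (memLp_two_iff_integrable_sq hv).2 hv2)
  simpa [Real.sqrt_eq_rpow] using h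

/-- Cauchy–Schwarz against the constant function on an interval. -/
theorem integral_norm_le_sqrt_mul {f : ℝ → ℂ} (hf : Continuous f)
    (hf2 : Integrable fun ξ ↦ ‖f ξ‖ ^ 2) {a b : ℝ} (hab : a ≤ b) :
    ∫ ξ in a..b, ‖f ξ‖ ≤ √(b - a) * √(∫ ξ, ‖f ξ‖ ^ 2) := by
  rw [intervalIntegral.integral_of_le hab]
  have h := integral_mul_le_sqrt_mul_sqrt (ν := volume.restrict (Set.Ioc a b)) (u := fun _ ↦ 1)
    (v := fun ξ ↦ ‖f ξ‖) (fun _ ↦ zero_le_one) (fun _ ↦ norm_nonneg _) aestronglyMeasurable_const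
    hf.norm.aestronglyMeasurable (integrable_const _) hf2.integrableOn
  have h1 : ∫ _ in Set.Ioc a b, (1 : ℝ) ^ 2 = b - a := by simp [hab]
  rw [h1] at h
  simp only [one_mul] at h
  refine h.trans ?_
  gcongr
  · exact Filter.Eventually.of_forall fun _ ↦ sq_nonneg _
  · exact Measure.restrict_le_self

section HalfLine

variable {x s τ A B M : ℝ} {f g g' k : ℝ → ℂ}

theorem integral_osc_scaled_div (x τ a b : ℝ) (hs : 0 < s) :
    ∫ ξ in a..b, osc x τ (s * ξ) / ξ = ∫ η in (s * a)..(s * b), osc x τ η / η := by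
  have h := intervalIntegral.integral_comp_mul_left (a := a) (b := b)
    (fun η ↦ osc x τ η / η) hs.ne'
  rw [eq_inv_smul_iff₀ hs.ne', ← intervalIntegral.integral_smul] at h
  rw [← h]
  congr 1; ext ξ
  have : (s : ℂ) ≠ 0 := by exact_mod_cast hs.ne'
  rw [Complex.real_smul]; push_cast
  rw [mul_div_assoc', mul_div_mul_left _ _ this]

theorem norm_integral_osc_mul_le_near_zero (x : ℝ) {a : ℝ} (ha : 0 ≤ a) (hf : Continuous f)
    (hf2 : Integrable fun ξ ↦ ‖f ξ‖ ^ 2) (hA : √(∫ ξ, ‖f ξ‖ ^ 2) ≤ A) :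
    ‖∫ ξ in (0)..a, osc x τ (s * ξ) * f ξ‖ ≤ √a * A := by
  refine (intervalIntegral.norm_integral_le_integral_norm ha).trans ?_
  simp only [norm_mul, norm_osc, one_mul]
  have := integral_norm_le_sqrt_mul hf hf2 ha
  rw [sub_zero] at this
  exact this.trans (by gcongr)

theorem norm_integral_osc_mul_le_low (x : ℝ) {a : ℝ} (hs : 0 < s) (hτ : 0 < τ) (ha : 0 < a)
    (has : a ≤ 1 / s) (hg : ∀ ξ, g ξ = ξ * f ξ)
    (hgd : ∀ ξ, HasDerivAt g (g' ξ) ξ) (hg'c : Continuous g')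
    (hg'2 : Integrable fun ξ ↦ ‖g' ξ‖ ^ 2) (hB : √(∫ ξ, ‖g' ξ‖ ^ 2) ≤ B) :
    ‖∫ ξ in a..(1 / s), osc x τ (s * ξ) * f ξ‖ ≤ 64 * B / (√τ * (s * √s) * a) := by
  set c := 1 / s with hc
  have hsτ := Real.sqrt_pos.2 hτ
  have hss := Real.sqrt_pos.2 hs
  have hB0 : 0 ≤ B := (Real.sqrt_nonneg _).trans hB
  set D := 32 / (√τ * (s * √s)) with hD
  have hD0 : 0 < D := by positivity
  set θ : ℝ → ℂ := fun ξ ↦ osc x τ (s * ξ) / ξ with hθ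
  have hpos : ∀ ξ ∈ Set.Icc a c, 0 < ξ := fun ξ hξ ↦ ha.trans_le hξ.1
  have hosc : Continuous fun ξ ↦ osc x τ (s * ξ) := (continuous_osc x τ).comp (by fun_prop)
  have hθc : ContinuousOn θ (Set.Ioi 0) := hosc.continuousOn.div
    Complex.continuous_ofReal.continuousOn fun ξ hξ ↦ by exact_mod_cast (ne_of_gt hξ)
  set E : ℝ → ℂ := fun ξ ↦ ∫ ζ in ξ..c, θ ζ with hE
  have hE_le : ∀ ξ ∈ Set.Icc a c, ‖E ξ‖ ≤ D / (√ξ * ξ) := fun ξ hξ ↦ by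
    have h0 := hpos ξ hξ
    simp only [hE, hθ]
    rw [integral_osc_scaled_div x τ ξ c hs]
    refine (norm_integral_osc_div_le_low x hτ (mul_pos hs h0)
      (mul_le_mul_of_nonneg_left hξ.2 hs.le) (by rw [hc]; field_simp; rfl)).trans (le_of_eq ?_)
    rw [Real.sqrt_mul hs.le, hD]
    have := Real.sqrt_pos.2 h0
    field_simp
  have hEd : ∀ ξ ∈ Set.uIcc a c, HasDerivAt E (-θ ξ) ξ := fun ξ hξ ↦ by
    rw [Set.uIcc_of_le has] at hξ
    have h0 := hpos ξ hξ
    refine intervalIntegral.integral_hasDerivAt_left ?_ ?_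
      (hθc.continuousAt (Ioi_mem_nhds h0))
    · refine (hθc.mono fun ζ hζ ↦ ?_).intervalIntegrable
      rw [Set.uIcc_of_le hξ.2] at hζ
      exact h0.trans_le hζ.1
    · exact hθc.stronglyMeasurableAtFilter isOpen_Ioi ξ h0
  have hEc : ContinuousOn E (Set.uIcc a c) := fun ξ hξ ↦
    (hEd ξ hξ).continuousAt.continuousWithinAt
  have hθi : IntervalIntegrable (fun ξ ↦ -θ ξ) volume a c := by
    refine (hθc.mono fun ζ hζ ↦ ?_).neg.intervalIntegrable
    rw [Set.uIcc_of_le has] at hζ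
    exact hpos ζ hζ
  have key := intervalIntegral.integral_mul_deriv_eq_deriv_mul hEd (fun ξ _ ↦ hgd ξ) hθi
    (hg'c.intervalIntegrable a c)
  have hEc0 : E c = 0 := intervalIntegral.integral_same
  have h1 : ∫ ξ in a..c, -θ ξ * g ξ = -∫ ξ in a..c, osc x τ (s * ξ) * f ξ := by
    rw [← intervalIntegral.integral_neg]
    refine intervalIntegral.integral_congr fun ξ hξ ↦ ?_
    rw [Set.uIcc_of_le has] at hξ
    have : (ξ : ℂ) ≠ 0 := by exact_mod_cast (hpos ξ hξ).ne'
    simp only [hθ, hg]; field_simp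
  rw [h1, hEc0, zero_mul, zero_sub, sub_neg_eq_add] at key
  have h2 : ∫ ξ in a..c, osc x τ (s * ξ) * f ξ = (∫ ξ in a..c, E ξ * g' ξ) + E a * g a := by
    rw [key]; ring
  have hga : ‖g a‖ ≤ √a * B := by
    have h3 : ∫ ξ in (0)..a, g' ξ = g a - g 0 :=
      intervalIntegral.integral_eq_sub_of_hasDerivAt (fun ξ _ ↦ hgd ξ)
        (hg'c.intervalIntegrable 0 a)
    have h4 : g 0 = 0 := by simp [hg]
    rw [h4, sub_zero] at h3
    rw [← h3]
    refine (intervalIntegral.norm_integral_le_integral_norm ha.le).trans ?_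
    have := integral_norm_le_sqrt_mul hg'c hg'2 ha.le
    rw [sub_zero] at this
    exact this.trans (by gcongr)
  have hsa := Real.sqrt_pos.2 ha
  have h5 : ‖E a * g a‖ ≤ D * B / a := by
    rw [norm_mul]
    calc ‖E a‖ * ‖g a‖ ≤ D / (√a * a) * (√a * B) := by
          gcongr; exact hE_le a ⟨le_rfl, has⟩
      _ = _ := by field_simp
  have h6 : ‖∫ ξ in a..c, E ξ * g' ξ‖ ≤ D * B / a := by
    refine (intervalIntegral.norm_integral_le_integral_norm has).trans ?_
    simp only [norm_mul]
    rw [intervalIntegral.integral_of_le has]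
    have hEm : ContinuousOn (fun ξ ↦ ‖E ξ‖) (Set.Icc a c) := by
      rw [← Set.uIcc_of_le has]; exact hEc.norm
    have hEi : IntegrableOn (fun ξ ↦ ‖E ξ‖ ^ 2) (Set.Ioc a c) :=
      ((hEm.pow 2).integrableOn_Icc).mono_set Set.Ioc_subset_Icc_self
    refine (integral_mul_le_sqrt_mul_sqrt (ν := volume.restrict (Set.Ioc a c))
      (fun _ ↦ norm_nonneg _) (fun _ ↦ norm_nonneg _)
      ((hEm.mono Set.Ioc_subset_Icc_self).aestronglyMeasurable measurableSet_Ioc)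
      hg'c.norm.aestronglyMeasurable hEi hg'2.integrableOn).trans ?_
    have h7 : ∫ ξ in Set.Ioc a c, ‖E ξ‖ ^ 2 ≤ (D / a) ^ 2 := by
      have hci : ContinuousOn (fun ξ : ℝ ↦ D ^ 2 * (1 / ξ ^ 3)) (Set.uIcc a c) := by
        rw [Set.uIcc_of_le has]
        exact continuousOn_const.mul (continuousOn_const.div (continuousOn_pow 3)
          fun ξ hξ ↦ (pow_pos (hpos ξ hξ) 3).ne')
      have h8 : ∫ ξ in a..c, D ^ 2 * (1 / ξ ^ 3) = D ^ 2 / 2 * (1 / a ^ 2 - 1 / c ^ 2) := by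
        rw [intervalIntegral.integral_eq_sub_of_hasDerivAt
          (f := fun ξ ↦ -(D ^ 2 / 2 * (ξ ^ 2)⁻¹)) (fun ξ hξ ↦ ?_) hci.intervalIntegrable]
        · ring
        · rw [Set.uIcc_of_le has] at hξ
          have h0 := hpos ξ hξ
          refine (((hasDerivAt_pow 2 ξ).inv (pow_pos h0 2).ne').const_mul
            (D ^ 2 / 2)).neg.congr_deriv ?_
          field_simp; norm_num
      have h9 : ∫ ξ in Set.Ioc a c, ‖E ξ‖ ^ 2 ≤ ∫ ξ in Set.Ioc a c, D ^ 2 * (1 / ξ ^ 3) := by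
        refine setIntegral_mono_on hEi (hci.intervalIntegrable.1) measurableSet_Ioc
          fun ξ hξ ↦ ?_
        have hξ' := Set.Ioc_subset_Icc_self hξ
        have h0 := hpos ξ hξ'
        calc ‖E ξ‖ ^ 2 ≤ (D / (√ξ * ξ)) ^ 2 := by gcongr; exact hE_le ξ hξ'
          _ = _ := by
            rw [div_pow, mul_pow, Real.sq_sqrt h0.le]; ring
      rw [intervalIntegral.integral_of_le has] at h8
      rw [h8] at h9
      refine h9.trans ?_
      have : 0 ≤ 1 / c ^ 2 := by positivity
      have h10 : (D / a) ^ 2 = D ^ 2 / 2 * (1 / a ^ 2 + 1 / a ^ 2) := by field_simp; norm_num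
      rw [h10]
      have : 0 ≤ 1 / a ^ 2 := by positivity
      gcongr
      linarith
    calc _ ≤ D / a * B := by
          gcongr
          · exact Real.sqrt_le_iff.2 ⟨by positivity, h7⟩
          · refine le_trans (Real.sqrt_le_sqrt ?_) hB
            exact integral_mono_measure Measure.restrict_le_self
              (Filter.Eventually.of_forall fun _ ↦ sq_nonneg _) hg'2
      _ = _ := by ring
  rw [h2]
  refine (norm_add_le _ _).trans ((add_le_add h6 h5).trans (le_of_eq ?_))
  rw [hD]; field_simp; ring

theorem norm_integral_osc_mul_le_high (x : ℝ) {b : ℝ} (hs : 0 < s) (hτ : 0 < τ) (hb : 1 / s ≤ b)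
    (hg : ∀ ξ, g ξ = ξ * f ξ) (hk : Integrable k)
    (hgk : ∀ ξ : ℝ, g ξ = ∫ y, Complex.exp (-(Complex.I * ((y * ξ : ℝ) : ℂ))) * k y)
    (hM : ∫ y, ‖k y‖ ≤ M) :
    ‖∫ ξ in (1 / s)..b, osc x τ (s * ξ) * f ξ‖ ≤ 320 / √τ * M := by
  have hc : 0 < 1 / s := by positivity
  have hpos : ∀ ξ ∈ Set.uIcc (1 / s) b, 0 < ξ := fun ξ hξ ↦ by
    rw [Set.uIcc_of_le hb] at hξ; exact hc.trans_le hξ.1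
  set F : ℝ → ℝ → ℂ := fun ξ y ↦ osc (x - y / s) τ (s * ξ) / ξ * k y with hF
  have h1 : ∫ ξ in (1 / s)..b, osc x τ (s * ξ) * f ξ = ∫ ξ in (1 / s)..b, ∫ y, F ξ y := by
    refine intervalIntegral.integral_congr fun ξ hξ ↦ ?_
    have h0 : (ξ : ℂ) ≠ 0 := by exact_mod_cast (hpos ξ hξ).ne'
    have h2 : f ξ = g ξ / ξ := by rw [hg]; field_simp
    rw [h2, hgk, ← integral_div, ← integral_const_mul]
    congr 1; ext y
    simp only [hF, osc]
    have hs' : (s : ℂ) ≠ 0 := by exact_mod_cast hs.ne'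
    rw [mul_div_right_comm, ← mul_assoc, mul_div_assoc', ← Complex.exp_add]
    congr 3
    push_cast; field_simp; ring
  have hoscc : Continuous fun z : ℝ × ℝ ↦ osc (x - z.2 / s) τ (s * z.1) := by
    have := continuous_dispersion
    unfold osc
    fun_prop
  have hint : Integrable (Function.uncurry F)
      ((volume.restrict (Set.uIoc (1 / s) b)).prod volume) := by
    have h3 : Integrable (fun z : ℝ × ℝ ↦ s * ‖k z.2‖)
        ((volume.restrict (Set.uIoc (1 / s) b)).prod volume) := by
      have : IsFiniteMeasure (volume.restrict (Set.uIoc (1 / s) b)) := by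
        rw [Set.uIoc_of_le hb]; infer_instance
      exact (integrable_const s).mul_prod hk.norm
    refine h3.mono ?_ ?_
    · refine AEStronglyMeasurable.mul ?_ hk.aestronglyMeasurable.comp_snd
      exact (hoscc.measurable.div
        (Complex.measurable_ofReal.comp measurable_fst)).aestronglyMeasurable
    · have h4 : ∀ᵐ ξ ∂(volume.restrict (Set.uIoc (1 / s) b)), 1 / s ≤ ξ := by
        rw [Set.uIoc_of_le hb]
        filter_upwards [ae_restrict_mem measurableSet_Ioc] with ξ hξ using hξ.1.le
      filter_upwards [Measure.quasiMeasurePreserving_fst.ae h4] with z hz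
      have hz0 : 0 < z.1 := hc.trans_le hz
      simp only [Function.uncurry, hF]
      rw [norm_mul, norm_div, norm_osc, Complex.norm_real, Real.norm_of_nonneg hz0.le, norm_mul,
        Real.norm_of_nonneg hs.le, norm_norm]
      gcongr
      rw [div_le_iff₀ hz0]
      rwa [div_le_iff₀' hs] at hz
  rw [h1, intervalIntegral_integral_swap hint]
  have h5 : ∀ y, ‖∫ ξ in (1 / s)..b, F ξ y‖ ≤ 320 / √τ * ‖k y‖ := fun y ↦ by
    simp only [hF]
    rw [intervalIntegral.integral_mul_const, norm_mul, integral_osc_scaled_div _ _ _ _ hs,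
      mul_one_div_cancel hs.ne']
    gcongr
    exact norm_integral_osc_div_le_high _ hτ (by rwa [div_le_iff₀' hs] at hb)
  refine (norm_integral_le_of_norm_le (hk.norm.const_mul _)
    (Filter.Eventually.of_forall h5)).trans ?_
  rw [integral_const_mul]
  gcongr

/-- Decay on the half line `(0, ∞)` for an amplitude `f` such that `ξ f(ξ)` is both the Fourier
transform of an integrable function and the primitive of a square integrable one. -/
theorem norm_integral_Ioi_osc_mul_le (x : ℝ) (hs : 0 < s) (hτ : 0 < τ) (hf : Continuous f)
    (hfi : Integrable f) (hf2 : Integrable fun ξ ↦ ‖f ξ‖ ^ 2) (hA : √(∫ ξ, ‖f ξ‖ ^ 2) ≤ A)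
    (hg : ∀ ξ, g ξ = ξ * f ξ) (hgd : ∀ ξ, HasDerivAt g (g' ξ) ξ) (hg'c : Continuous g')
    (hg'2 : Integrable fun ξ ↦ ‖g' ξ‖ ^ 2) (hB : √(∫ ξ, ‖g' ξ‖ ^ 2) ≤ B) (hk : Integrable k)
    (hgk : ∀ ξ : ℝ, g ξ = ∫ y, Complex.exp (-(Complex.I * ((y * ξ : ℝ) : ℂ))) * k y)
    (hM : ∫ y, ‖k y‖ ≤ M) :
    ‖∫ ξ in Set.Ioi 0, osc x τ (s * ξ) * f ξ‖
      ≤ 1 / √s * τ ^ (-(1 / 8) : ℝ) * (A + 64 * B) + 320 * τ ^ (-(1 / 2) : ℝ) * M := by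
  have hss := Real.sqrt_pos.2 hs
  have hsτ := Real.sqrt_pos.2 hτ
  have hA0 : 0 ≤ A := (Real.sqrt_nonneg _).trans hA
  have hB0 : 0 ≤ B := (Real.sqrt_nonneg _).trans hB
  have hc : 0 < 1 / s := by positivity
  have hsc : √(1 / s) = 1 / √s := by rw [Real.sqrt_div zero_le_one, Real.sqrt_one]
  have hosc : Continuous fun ξ ↦ osc x τ (s * ξ) := (continuous_osc x τ).comp (by fun_prop)
  have hFc : Continuous fun ξ ↦ osc x τ (s * ξ) * f ξ := hosc.mul hf
  have hFi : Integrable fun ξ ↦ osc x τ (s * ξ) * f ξ := by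
    refine hfi.norm.mono' hFc.aestronglyMeasurable (Filter.Eventually.of_forall fun ξ ↦ ?_)
    rw [norm_mul, norm_osc, one_mul]
  have hlow : ‖∫ ξ in (0)..(1 / s), osc x τ (s * ξ) * f ξ‖
      ≤ 1 / √s * τ ^ (-(1 / 8) : ℝ) * (A + 64 * B) := by
    rcases le_total τ 1 with h1 | h1
    · refine (norm_integral_osc_mul_le_near_zero x hc.le hf hf2 hA).trans ?_
      have h2 : 1 ≤ τ ^ (-(1 / 8) : ℝ) :=
        Real.one_le_rpow_of_pos_of_le_one_of_nonpos hτ h1 (by norm_num)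
      rw [hsc, mul_assoc]
      gcongr
      nlinarith
    · set d := τ ^ (-(1 / 4) : ℝ) with hd
      have hd0 : 0 < d := Real.rpow_pos_of_pos hτ _
      have hd1 : d ≤ 1 := Real.rpow_le_one_of_one_le_of_nonpos h1 (by norm_num)
      have ha : 0 < d / s := by positivity
      have has : d / s ≤ 1 / s := by gcongr
      rw [← intervalIntegral.integral_add_adjacent_intervals (b := d / s)
        (hFc.intervalIntegrable _ _) (hFc.intervalIntegrable _ _)]
      refine (norm_add_le _ _).trans ((add_le_add
        (norm_integral_osc_mul_le_near_zero x ha.le hf hf2 hA)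
        (norm_integral_osc_mul_le_low x hs hτ ha has hg hgd hg'c hg'2 hB)).trans ?_)
      have h2 : √d = τ ^ (-(1 / 8) : ℝ) := by
        rw [hd, Real.sqrt_eq_rpow, ← Real.rpow_mul hτ.le]; norm_num
      have h3 : 1 / (√τ * d) ≤ τ ^ (-(1 / 8) : ℝ) := by
        rw [hd, Real.sqrt_eq_rpow, ← Real.rpow_add hτ, one_div, ← Real.rpow_neg hτ.le]
        exact Real.rpow_le_rpow_of_exponent_le h1 (by norm_num)
      rw [Real.sqrt_div hd0.le, h2]
      calc _ = 1 / √s * τ ^ (-(1 / 8) : ℝ) * A + 1 / √s * (1 / (√τ * d)) * (64 * B) := by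
            field_simp
        _ ≤ 1 / √s * τ ^ (-(1 / 8) : ℝ) * A + 1 / √s * τ ^ (-(1 / 8) : ℝ) * (64 * B) := by
            gcongr
        _ = _ := by ring
  have hτ2 : τ ^ (-(1 / 2) : ℝ) = 1 / √τ := by
    rw [Real.rpow_neg hτ.le, ← Real.sqrt_eq_rpow, one_div]
  refine le_of_tendsto (intervalIntegral_tendsto_integral_Ioi 0 hFi.integrableOn
    Filter.tendsto_id).norm ?_
  filter_upwards [Filter.eventually_ge_atTop (1 / s)] with b hb
  rw [id, ← intervalIntegral.integral_add_adjacent_intervals (b := 1 / s)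
    (hFc.intervalIntegrable _ _) (hFc.intervalIntegrable _ _)]
  refine (norm_add_le _ _).trans (add_le_add hlow ?_)
  refine (norm_integral_osc_mul_le_high x hs hτ hb hg hk hgk hM).trans (le_of_eq ?_)
  rw [hτ2]; ring

end HalfLine

section Schwartz

open Real FourierTransform

/-- The Fourier transform with the convention `∫ exp(-iyξ) φ(y) dy`. -/
noncomputable def angularFourier (φ : ℝ → ℂ) (ξ : ℝ) : ℂ :=
  ∫ y : ℝ, Complex.exp (-(Complex.I * ((y * ξ : ℝ) : ℂ))) * φ y

theorem angularFourier_eq (φ : ℝ → ℂ) (ξ : ℝ) :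
    angularFourier φ ξ = 𝓕 φ (ξ / (2 * π)) := by
  rw [Real.fourier_real_eq_integral_exp_smul, angularFourier]
  congr 1; ext y
  rw [smul_eq_mul]
  congr 2
  have : (π : ℂ) ≠ 0 := by exact_mod_cast pi_ne_zero
  push_cast; field_simp

theorem angularFourier_schwartz_eq (φ : SchwartzMap ℝ ℂ) :
    angularFourier φ = fun ξ ↦ (𝓕 φ) (ξ / (2 * π)) := by
  ext ξ; rw [angularFourier_eq, SchwartzMap.fourier_coe]

theorem continuous_angularFourier (φ : SchwartzMap ℝ ℂ) : Continuous (angularFourier φ) := by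
  rw [angularFourier_schwartz_eq]; fun_prop

theorem integrable_angularFourier (φ : SchwartzMap ℝ ℂ) : Integrable (angularFourier φ) := by
  rw [angularFourier_schwartz_eq]
  exact (SchwartzMap.integrable (𝓕 φ)).comp_div two_pi_pos.ne'

theorem integrable_norm_sq_schwartz (φ : SchwartzMap ℝ ℂ) : Integrable fun ξ ↦ ‖φ ξ‖ ^ 2 :=
  (memLp_two_iff_integrable_sq_norm φ.continuous.aestronglyMeasurable).1 (φ.memLp 2)

theorem integrable_norm_sq_angularFourier (φ : SchwartzMap ℝ ℂ) :
    Integrable fun ξ ↦ ‖angularFourier φ ξ‖ ^ 2 := by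
  rw [angularFourier_schwartz_eq]
  exact (integrable_norm_sq_schwartz (𝓕 φ)).comp_div two_pi_pos.ne'

theorem sqrt_integral_norm_sq_angularFourier_le (φ : SchwartzMap ℝ ℂ) :
    √(∫ ξ, ‖angularFourier φ ξ‖ ^ 2) ≤ 3 * √(∫ y, ‖φ y‖ ^ 2) := by
  rw [angularFourier_schwartz_eq]
  beta_reduce
  rw [Measure.integral_comp_div (fun w ↦ ‖(𝓕 φ : SchwartzMap ℝ ℂ) w‖ ^ 2), SchwartzMap.integral_norm_sq_fourier,
    smul_eq_mul, sqrt_mul (abs_nonneg _)]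
  gcongr
  rw [abs_of_pos two_pi_pos, sqrt_le_iff]
  exact ⟨by norm_num, by linarith [pi_lt_d2]⟩

theorem angularFourier_derivCLM (φ : SchwartzMap ℝ ℂ) (ξ : ℝ) :
    angularFourier (SchwartzMap.derivCLM ℂ ℂ φ) ξ = Complex.I * ξ * angularFourier φ ξ := by
  have h : (SchwartzMap.derivCLM ℂ ℂ φ : ℝ → ℂ) = deriv φ := by
    ext y; exact SchwartzMap.derivCLM_apply ℂ φ y
  have hi : Integrable (deriv φ) := by
    rw [← h]; exact SchwartzMap.integrable _
  rw [angularFourier_eq, h, Real.fourier_deriv φ.integrable φ.differentiable hi,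
    angularFourier_eq]
  beta_reduce
  rw [smul_eq_mul]
  congr 1
  have : (π : ℂ) ≠ 0 := by exact_mod_cast pi_ne_zero
  push_cast; field_simp

theorem hasDerivAt_angularFourier {φ χ : SchwartzMap ℝ ℂ} (h : ∀ y, χ y = y * φ y) (ξ : ℝ) :
    HasDerivAt (angularFourier φ) (-Complex.I * angularFourier χ ξ) ξ := by
  have hπ : (π : ℂ) ≠ 0 := by exact_mod_cast pi_ne_zero
  have hi : Integrable fun y : ℝ ↦ y • φ y := by
    refine (SchwartzMap.integrable χ).congr (Filter.Eventually.of_forall fun y ↦ ?_)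
    simp [h]
  have h1 : angularFourier φ = fun ξ ↦ 𝓕 (φ : ℝ → ℂ) (ξ / (2 * π)) :=
    funext fun ξ ↦ angularFourier_eq φ ξ
  rw [h1]
  refine ((Real.hasDerivAt_fourier φ.integrable hi _).scomp ξ
    ((hasDerivAt_id' ξ).div_const (2 * π))).congr_deriv ?_
  have h2 : (fun y : ℝ ↦ (-2 * (π : ℂ) * Complex.I * y) • φ y)
      = fun y ↦ (-2 * (π : ℂ) * Complex.I) * χ y := by
    ext y; rw [h, smul_eq_mul]; ring
  rw [h2, ← angularFourier_eq, Complex.real_smul, angularFourier, angularFourier,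
    ← integral_const_mul, ← integral_const_mul]
  congr 1; ext y; push_cast; field_simp

/-- The norm `‖φ‖_{H¹} + ‖y φ'‖_{L²}`. -/
noncomputable def decayNorm (φ : ℝ → ℂ) : ℝ :=
  √((∫ y : ℝ, ‖φ y‖ ^ 2) + ∫ y : ℝ, ‖deriv φ y‖ ^ 2) + √(∫ y : ℝ, y ^ 2 * ‖deriv φ y‖ ^ 2)

/-- The weighted `L²` bound for the `L¹` norm of a Schwartz function. -/
theorem integral_norm_le_of_weighted {φ χ : SchwartzMap ℝ ℂ} (h : ∀ y, χ y = y * φ y) :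
    ∫ y, ‖φ y‖ ≤ 2 * (√(∫ y, ‖φ y‖ ^ 2) + √(∫ y, ‖χ y‖ ^ 2)) := by
  have hpos : ∀ y : ℝ, 0 < 1 + y ^ 2 := fun y ↦ by positivity
  have e1 : ∀ y : ℝ, √((1 + y ^ 2)⁻¹) ^ 2 = (1 + y ^ 2)⁻¹ := fun y ↦
    sq_sqrt (inv_nonneg.2 (hpos y).le)
  have e2 : ∀ y : ℝ, (√(1 + y ^ 2) * ‖φ y‖) ^ 2 = ‖φ y‖ ^ 2 + ‖χ y‖ ^ 2 := fun y ↦ by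
    rw [mul_pow, sq_sqrt (hpos y).le, h, norm_mul, Complex.norm_real, mul_pow, norm_eq_abs, sq_abs]
    ring
  have key := integral_mul_le_sqrt_mul_sqrt (ν := volume) (u := fun y : ℝ ↦ √((1 + y ^ 2)⁻¹))
    (v := fun y ↦ √(1 + y ^ 2) * ‖φ y‖) (fun _ ↦ sqrt_nonneg _) (fun _ ↦ by positivity)
    (by fun_prop) (Continuous.aestronglyMeasurable (by fun_prop))
    (by simp only [e1]; exact integrable_inv_one_add_sq)
    (by simp only [e2]; exact (integrable_norm_sq_schwartz φ).add (integrable_norm_sq_schwartz χ))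
  have e3 : ∀ y : ℝ, √((1 + y ^ 2)⁻¹) * (√(1 + y ^ 2) * ‖φ y‖) = ‖φ y‖ := fun y ↦ by
    have := sqrt_pos.2 (hpos y)
    rw [sqrt_inv, inv_mul_cancel_left₀ this.ne']
  simp only [e1, e2, e3] at key
  rw [integral_univ_inv_one_add_sq,
    integral_add (integrable_norm_sq_schwartz φ) (integrable_norm_sq_schwartz χ)] at key
  refine key.trans ?_
  gcongr
  · exact sqrt_le_iff.2 ⟨by norm_num, by linarith [pi_lt_d2]⟩
  · have h1 : 0 ≤ ∫ y, ‖φ y‖ ^ 2 := integral_nonneg fun _ ↦ sq_nonneg _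
    have h2 : 0 ≤ ∫ y, ‖χ y‖ ^ 2 := integral_nonneg fun _ ↦ sq_nonneg _
    refine sqrt_le_iff.2 ⟨by positivity, ?_⟩
    rw [add_sq, sq_sqrt h1, sq_sqrt h2]
    have : 0 ≤ 2 * √(∫ y, ‖φ y‖ ^ 2) * √(∫ y, ‖χ y‖ ^ 2) := by positivity
    linarith

theorem norm_integral_Ioi_osc_mul_angularFourier_le (φ : SchwartzMap ℝ ℂ) (x : ℝ) {s τ : ℝ}
    (hs : 0 < s) (hτ : 0 < τ) :
    ‖∫ ξ in Set.Ioi 0, osc x τ (s * ξ) * angularFourier φ ξ‖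
      ≤ 1280 * (1 / √s * τ ^ (-(1 / 8) : ℝ) + τ ^ (-(1 / 2) : ℝ)) * decayNorm φ := by
  set φ' := SchwartzMap.derivCLM ℂ ℂ φ with hφ'
  set χ := SchwartzMap.smulLeftCLM ℂ (fun y : ℝ ↦ y) φ' with hχ
  have hφ'a : ∀ y, φ' y = deriv φ y := fun y ↦ SchwartzMap.derivCLM_apply ℂ φ y
  have hχa : ∀ y, χ y = y * φ' y := fun y ↦ by
    rw [hχ, SchwartzMap.smulLeftCLM_apply_apply (by fun_prop), Complex.real_smul]
  have hχn : ∀ y, ‖χ y‖ ^ 2 = y ^ 2 * ‖deriv φ y‖ ^ 2 := fun y ↦ by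
    rw [hχa, norm_mul, mul_pow, Complex.norm_real, norm_eq_abs, sq_abs, hφ'a]
  have hN : decayNorm φ
      = √((∫ y : ℝ, ‖φ y‖ ^ 2) + ∫ y : ℝ, ‖φ' y‖ ^ 2) + √(∫ y : ℝ, ‖χ y‖ ^ 2) := by
    simp only [hχn, hφ'a, decayNorm]
  have hn : ∀ φ : SchwartzMap ℝ ℂ, 0 ≤ ∫ y : ℝ, ‖φ y‖ ^ 2 := fun φ ↦
    integral_nonneg fun _ ↦ sq_nonneg _
  have hN1 : √(∫ y : ℝ, ‖φ y‖ ^ 2) ≤ decayNorm φ := by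
    rw [hN]
    have := sqrt_le_sqrt (le_add_of_nonneg_right (a := ∫ y : ℝ, ‖φ y‖ ^ 2) (hn φ'))
    linarith [sqrt_nonneg (∫ y : ℝ, ‖χ y‖ ^ 2)]
  have hN2 : √(∫ y : ℝ, ‖φ' y‖ ^ 2) + √(∫ y : ℝ, ‖χ y‖ ^ 2) ≤ decayNorm φ := by
    rw [hN]
    gcongr
    exact le_add_of_nonneg_left (hn φ)
  have hN3 : √(∫ y : ℝ, ‖χ y‖ ^ 2) ≤ decayNorm φ := by
    linarith [sqrt_nonneg (∫ y : ℝ, ‖φ' y‖ ^ 2)]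
  have hN0 : 0 ≤ decayNorm φ := (sqrt_nonneg _).trans hN1
  have hg : ∀ ξ : ℝ, -Complex.I * angularFourier φ' ξ = ξ * angularFourier φ ξ := fun ξ ↦ by
    rw [hφ', angularFourier_derivCLM]
    linear_combination (-(ξ : ℂ) * angularFourier φ ξ) * Complex.I_sq
  have hgd : ∀ ξ, HasDerivAt (fun ξ ↦ -Complex.I * angularFourier φ' ξ)
      (-angularFourier χ ξ) ξ := fun ξ ↦ by
    refine ((hasDerivAt_angularFourier hχa ξ).const_mul (-Complex.I)).congr_deriv ?_
    linear_combination (angularFourier χ ξ) * Complex.I_sq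
  have key := norm_integral_Ioi_osc_mul_le (A := 3 * decayNorm φ) (B := 3 * decayNorm φ)
    (M := 2 * decayNorm φ) (k := fun y ↦ -Complex.I * φ' y) x hs hτ
    (continuous_angularFourier φ) (integrable_angularFourier φ)
    (integrable_norm_sq_angularFourier φ)
    ((sqrt_integral_norm_sq_angularFourier_le φ).trans (by gcongr)) hg hgd
    (continuous_angularFourier χ).neg
    (by simpa only [norm_neg] using integrable_norm_sq_angularFourier χ)
    (by
      simp only [norm_neg]
      exact (sqrt_integral_norm_sq_angularFourier_le χ).trans (by gcongr))
    ((SchwartzMap.integrable φ').const_mul _)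
    (fun ξ ↦ by
      rw [angularFourier, ← integral_const_mul]
      congr 1; ext y; ring)
    (by
      simp only [norm_mul, norm_neg, Complex.norm_I, one_mul]
      exact (integral_norm_le_of_weighted hχa).trans (by gcongr))
  refine key.trans ?_
  have h1 : 0 ≤ 1 / √s * τ ^ (-(1 / 8) : ℝ) * decayNorm φ := by positivity
  have h2 : 0 ≤ τ ^ (-(1 / 2) : ℝ) * decayNorm φ := by positivity
  linarith

/-- The reflection `y ↦ φ (-y)` of a Schwartz function. -/
noncomputable def schwartzReflect (φ : SchwartzMap ℝ ℂ) : SchwartzMap ℝ ℂ :=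
  SchwartzMap.compCLMOfContinuousLinearEquiv ℂ (ContinuousLinearEquiv.neg ℝ) φ

theorem schwartzReflect_apply (φ : SchwartzMap ℝ ℂ) (y : ℝ) : schwartzReflect φ y = φ (-y) := rfl

theorem angularFourier_schwartzReflect (φ : SchwartzMap ℝ ℂ) (ξ : ℝ) :
    angularFourier (schwartzReflect φ) ξ = angularFourier φ (-ξ) := by
  rw [angularFourier, angularFourier, ← integral_neg_eq_self]
  congr 1; ext y
  rw [schwartzReflect_apply, neg_neg, neg_mul, mul_neg]

theorem decayNorm_schwartzReflect (φ : SchwartzMap ℝ ℂ) :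
    decayNorm (schwartzReflect φ) = decayNorm φ := by
  have h : (schwartzReflect φ : ℝ → ℂ) = fun y ↦ φ (-y) := rfl
  have hd : ∀ y, ‖deriv (fun y ↦ φ (-y)) y‖ = ‖deriv φ (-y)‖ := fun y ↦ by
    rw [deriv_comp_neg, norm_neg]
  rw [decayNorm, decayNorm, h]
  simp only [hd]
  rw [integral_neg_eq_self (fun y ↦ ‖φ y‖ ^ 2), integral_neg_eq_self (fun y ↦ ‖deriv φ y‖ ^ 2),
    ← integral_neg_eq_self (fun y ↦ y ^ 2 * ‖deriv φ y‖ ^ 2)]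
  simp only [neg_sq]

theorem dispersion_neg (η : ℝ) : dispersion (-η) = dispersion η := by
  rw [dispersion, dispersion, tanh_neg, neg_mul_neg]

theorem norm_integral_osc_mul_angularFourier_le (φ : SchwartzMap ℝ ℂ) (x : ℝ) {s τ : ℝ}
    (hs : 0 < s) (hτ : 0 < τ) :
    ‖∫ ξ, osc x τ (s * ξ) * angularFourier φ ξ‖
      ≤ 2560 * (1 / √s * τ ^ (-(1 / 8) : ℝ) + τ ^ (-(1 / 2) : ℝ)) * decayNorm φ := by
  have hi : Integrable fun ξ ↦ osc x τ (s * ξ) * angularFourier φ ξ := by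
    refine (integrable_angularFourier φ).norm.mono' (Continuous.aestronglyMeasurable
      (((continuous_osc x τ).comp (by fun_prop)).mul (continuous_angularFourier φ)))
      (Filter.Eventually.of_forall fun ξ ↦ ?_)
    rw [norm_mul, norm_osc, one_mul]
  have h1 : ∫ ξ in Set.Iic 0, osc x τ (s * ξ) * angularFourier φ ξ
      = ∫ ξ in Set.Ioi 0, osc (-x) τ (s * ξ) * angularFourier (schwartzReflect φ) ξ := by
    have h := integral_comp_neg_Ioi 0 fun ξ ↦ osc x τ (s * ξ) * angularFourier φ ξ
    rw [neg_zero] at h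
    rw [← h]
    congr 1; ext ξ
    rw [angularFourier_schwartzReflect, osc, osc, mul_neg, dispersion_neg, mul_neg, neg_mul]
  rw [← intervalIntegral.integral_Iic_add_Ioi hi.integrableOn hi.integrableOn (b := 0), h1]
  have h2 := norm_integral_Ioi_osc_mul_angularFourier_le φ x hs hτ
  have h3 := norm_integral_Ioi_osc_mul_angularFourier_le (schwartzReflect φ) (-x) hs hτ
  rw [decayNorm_schwartzReflect] at h3
  exact (norm_add_le _ _).trans (by linarith)

/-- The phase of the group is the normalised one after rescaling frequencies by `√μ`. -/
theorem exp_water_waves_phase_eq {μ : ℝ} (hμ : 0 < μ) (t x ξ : ℝ) :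
    Complex.exp (Complex.I * ((x * ξ + t * √(|ξ| * tanh (√μ * |ξ|) / √μ) : ℝ) : ℂ))
      = osc (x / √μ) (t / √μ) (√μ * ξ) := by
  have hs := sqrt_pos.2 hμ
  have h1 : √(|ξ| * tanh (√μ * |ξ|) / √μ) = dispersion (√μ * ξ) / √μ := by
    have h2 : dispersion (√μ * ξ) = dispersion (√μ * |ξ|) := by
      rcases abs_choice ξ with h | h <;> rw [h]
      rw [mul_neg, dispersion_neg]
    rw [h2, dispersion, eq_div_iff hs.ne']
    nth_rw 3 [← sqrt_sq hs.le]
    rw [← sqrt_mul' _ (sq_nonneg _)]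
    congr 1
    field_simp
  rw [h1, osc]
  congr 3
  field_simp

end Schwartz

/-- Dispersive decay estimate, uniform in the shallowness parameter `μ`, for
the evolution group `e^{itω(D)}` of the linearized water-waves equations
with flat bottom in dimension `1`, where
`ω(ξ) = sqrt(|ξ| tanh(√μ|ξ|)/√μ)`. -/
theorem water_waves_dispersive_estimate :
    ∃ C : ℝ, 0 < C ∧
      ∀ (μ t : ℝ), 0 < μ → 0 < t → ∀ (φ : SchwartzMap ℝ ℂ) (x : ℝ),
        ‖(1 / (2 * (Real.pi : ℂ))) *
            ∫ ξ : ℝ, Complex.exp (Complex.I *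
                ((x * ξ + t * Real.sqrt (|ξ| * Real.tanh (Real.sqrt μ * |ξ|) /
                    Real.sqrt μ) : ℝ) : ℂ)) *
              (∫ y : ℝ, Complex.exp (-(Complex.I * ((y * ξ : ℝ) : ℂ))) * φ y)‖
          ≤ C * (μ ^ (-(1 / 4 : ℝ)) * (t / Real.sqrt μ) ^ (-(1 / 8 : ℝ))
                + (t / Real.sqrt μ) ^ (-(1 / 2 : ℝ))) *
            (Real.sqrt ((∫ y : ℝ, ‖φ y‖ ^ 2)
                + ∫ y : ℝ, ‖deriv (fun z : ℝ => φ z) y‖ ^ 2)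
              + Real.sqrt (∫ y : ℝ, y ^ 2 * ‖deriv (fun z : ℝ => φ z) y‖ ^ 2)) := by
  refine ⟨1280, by norm_num, fun μ t hμ ht φ x ↦ ?_⟩
  have hs := Real.sqrt_pos.2 hμ
  have hτ : 0 < t / √μ := by positivity
  have key := norm_integral_osc_mul_angularFourier_le φ (x / √μ) hs hτ
  simp only [← exp_water_waves_phase_eq hμ] at key
  have hμ4 : μ ^ (-(1 / 4) : ℝ) = 1 / √(√μ) := by
    rw [Real.sqrt_eq_rpow, Real.sqrt_eq_rpow, ← Real.rpow_mul hμ.le, Real.rpow_neg hμ.le, one_div]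
    norm_num
  have hN : 0 ≤ decayNorm φ := by unfold decayNorm; positivity
  change _ ≤ _ * decayNorm φ
  rw [hμ4, norm_mul]
  have h1 : ‖1 / (2 * (Real.pi : ℂ))‖ ≤ 1 / 2 := by
    rw [norm_div, norm_one, norm_mul, Complex.norm_real, Complex.norm_ofNat,
      Real.norm_of_nonneg Real.pi_pos.le]
    gcongr
    linarith [Real.pi_gt_three]
  refine (mul_le_mul h1 key (norm_nonneg _) (by norm_num)).trans (le_of_eq ?_)
  ring
end
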